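/- Let d = 2, E > 0, r₀ > 0, and set Y = {x ∈ ℝ² : |x| ≥ r₀}. Let V : ℝ² → ℝ be bounded and measurable with V(x) = 0 for |x| ≤ r₀/3 and V(x) ≤ p(|x|) for all x, where p : [0,∞) → (0,∞) is nonincreasing with p(r) → 0 as r → ∞, and assume that for each unit vector w the function r ↦ V(rw) is locally Lipschitz on [0,∞) with (d/dr)V(rw) ≤ C₂(r+1)^{−β} almost everywhere, for constants C₂ > 0 and β > 1. Set k = (1/4)min{1, β−1}, fix s with 1/2 < s < (1/4)min{3, β+1} and ℓ > 0 with kℓ > 2 and (β − 2k − 2s)ℓ > 2. Then there exist constants τ₀ ≥ 1 and C > 0 such that the following holds for all 0 < h ≤ 1 and 0 < ε ≤ 1: with τ = τ₀, a = τ₀^ℓ, and φ the phase function built from k, τ, a as in the context, for every smooth compactly supported f : ℝ² → ℂ with f(x) = 0 and ∇f(x) = 0 whenever |x| = r₀, and both choices of sign ±: ‖(|x|+1)^{−s} e^{φ(|x|)/h} f‖_{L²(Y)} + ‖(|x|+1)^{−s} e^{φ(|x|)/h} D_r f‖_{L²(Y)} ≤ C a² h^{−1} ‖(|x|+1)^{s}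 e^{φ(|x|)/h} (−h²Δf + (V − E ± iε) f)‖_{L²(Y)} + C τ a (ε/h)^{1/2} ‖e^{φ(|x|)/h} f‖_{L²(Y)}, where (D_r f)(x) = −ih (x/|x|)·∇f(x). -/

import Mathlib

open MeasureTheory

/-- The derivative φ′ of the phase function. -/
noncomputable def phiDeriv (k τ a r : ℝ) : ℝ :=
  if r ≤ a then τ * ((r + 1) ^ (-k) - (a + 1) ^ (-k)) else 0

/-- The phase function φ(r) = ∫₀^r φ′(t) dt. -/
noncomputable def phi (k τ a r : ℝ) : ℝ :=
  ∫ t in (0:ℝ)..r, phiDeriv k τ a t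

/-- The Laplacian of a function on ℝ², as the sum of the second derivatives
along the coordinate directions. -/
noncomputable def lap (f : EuclideanSpace ℝ (Fin 2) → ℂ)
    (x : EuclideanSpace ℝ (Fin 2)) : ℂ :=
  ∑ i : Fin 2,
    fderiv ℝ (fun y => fderiv ℝ f y (EuclideanSpace.single i 1)) x (EuclideanSpace.single i 1)

/-- The radial semiclassical derivative D_r f = −ih (x/|x|)·∇f. -/
noncomputable def radialDeriv (h : ℝ) (f : EuclideanSpace ℝ (Fin 2) → ℂ)
    (x : EuclideanSpace ℝ (Fin 2)) : ℂ :=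
  -Complex.I * (h:ℂ) * fderiv ℝ f x (‖x‖⁻¹ • x)

open Set

/-- Integration by parts against an absolutely continuous function whose derivative is bounded
above, for a nonnegative function vanishing at both endpoints. -/
theorem integral_deriv_mul_add_nonneg {ψ ψ' W B : ℝ → ℝ} {r₀ R a : ℝ} (hle : r₀ ≤ R)
    (hψc : ContinuousOn ψ (Icc r₀ R))
    (hψd : ∀ r ∈ Ioo r₀ R, r ≠ a → HasDerivAt ψ (ψ' r) r)
    (hψi : IntervalIntegrable ψ' volume r₀ R) (h0 : ψ r₀ = 0) (hR : ψ R = 0)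
    (hψ : ∀ r ∈ Icc r₀ R, 0 ≤ ψ r) (hW : AbsolutelyContinuousOnInterval W r₀ R)
    (hB : ContinuousOn B (Icc r₀ R)) (hWB : ∀ᵐ r, r ∈ Icc r₀ R → deriv W r ≤ B r) :
    0 ≤ ∫ r in r₀..R, (ψ' r * W r + B r * ψ r) := by
  set Ψ : ℝ → ℝ := fun r => ∫ t in r₀..r, ψ' t with hΨ
  have hΨψ : ∀ r ∈ Icc r₀ R, Ψ r = ψ r := by
    intro r hr
    have := integral_eq_of_hasDerivAt_off_countable_of_le ψ ψ' hr.1 (countable_singleton a)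
      (hψc.mono (Icc_subset_Icc_right hr.2))
      (fun x hx => hψd x ⟨hx.1.1, hx.1.2.trans_le hr.2⟩ (by simpa using hx.2))
      (hψi.mono_set (by
        rw [uIcc_of_le hr.1, uIcc_of_le hle]; exact Icc_subset_Icc_right hr.2))
    simp only [hΨ, this, h0, sub_zero]
  have hΨac : AbsolutelyContinuousOnInterval Ψ r₀ R :=
    hψi.absolutelyContinuousOnInterval_intervalIntegral left_mem_uIcc
  have key := hΨac.integral_mul_deriv_eq_deriv_mul hW
  rw [hΨψ R ⟨hle, le_rfl⟩, hΨψ r₀ ⟨le_rfl, hle⟩, h0, hR] at key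
  have hder : ∫ x in r₀..R, deriv Ψ x * W x = ∫ x in r₀..R, ψ' x * W x := by
    apply intervalIntegral.integral_congr_ae
    filter_upwards [hψi.ae_hasDerivAt_integral] with x hx hx'
    rw [(hx (uIoc_subset_uIcc hx') r₀ left_mem_uIcc).deriv]
  rw [← uIcc_of_le hle] at hψc hB
  have hWi : IntervalIntegrable (deriv W) volume r₀ R := hW.intervalIntegrable_deriv
  have i1 : IntervalIntegrable (fun r => ψ' r * W r) volume r₀ R :=
    hψi.mul_continuousOn hW.continuousOn
  have i2 : IntervalIntegrable (fun r => B r * ψ r) volume r₀ R :=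
    (hB.mul hψc).intervalIntegrable
  have i3 : IntervalIntegrable (fun r => Ψ r * deriv W r) volume r₀ R :=
    hWi.continuousOn_mul hΨac.continuousOn
  have hle2 : ∫ x in r₀..R, Ψ x * deriv W x ≤ ∫ x in r₀..R, B x * ψ x := by
    apply intervalIntegral.integral_mono_ae_restrict hle i3 i2
    rw [Filter.EventuallyLE, ae_restrict_iff' measurableSet_Icc]
    filter_upwards [hWB] with x hx hx'
    rw [hΨψ x hx', mul_comm]
    exact mul_le_mul_of_nonneg_right (hx hx') (hψ x hx')
  rw [intervalIntegral.integral_add i1 i2]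
  linarith

/-- The second derivative of the phase function, away from `r = a`. -/
noncomputable def phiDeriv₂ (k τ a r : ℝ) : ℝ :=
  if r ≤ a then -(k * τ * (r + 1) ^ (-k - 1)) else 0

/-- The radial weight multiplying the energy density. -/
noncomputable def radialWeight (k s a r : ℝ) : ℝ :=
  if r ≤ a then (r + 1) ^ (2 * k) - 1
  else (a + 1) ^ (2 * k) - 1 + (a + 1) ^ (1 - 2 * s) - (r + 1) ^ (1 - 2 * s)

/-- The derivative of the radial weight, away from `r = a`. -/
noncomputable def radialWeightDeriv (k s a r : ℝ) : ℝ :=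
  if r ≤ a then 2 * k * (r + 1) ^ (2 * k - 1) else (2 * s - 1) * (r + 1) ^ (-(2 * s))

section Weights

variable {k s a r τ : ℝ}

theorem radialWeightDeriv_nonneg (hk : 0 < k) (hs : 1 / 2 < s) (hr : 0 ≤ r) :
    0 ≤ radialWeightDeriv k s a r := by
  unfold radialWeightDeriv
  split_ifs
  · positivity
  · have : 0 ≤ 2 * s - 1 := by linarith
    positivity

theorem radialWeight_le (hk : 0 < k) (hs : 1 / 2 < s) (ha : 0 ≤ a) (hr : 0 ≤ r) :
    radialWeight k s a r ≤ (a + 1) ^ (2 * k) := by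
  unfold radialWeight
  split_ifs with h
  · have : (r + 1) ^ (2 * k) ≤ (a + 1) ^ (2 * k) := by gcongr
    linarith
  · have h1 : (a + 1) ^ (1 - 2 * s) ≤ 1 :=
      Real.rpow_le_one_of_one_le_of_nonpos (by linarith) (by linarith)
    have h2 : 0 ≤ (r + 1) ^ (1 - 2 * s) := by positivity
    linarith

theorem radialWeight_nonneg (hk : 0 < k) (hs : 1 / 2 < s) (ha : 0 ≤ a) (hr : 0 ≤ r) :
    0 ≤ radialWeight k s a r := by
  unfold radialWeight
  split_ifs with h
  · have : 1 ≤ (r + 1) ^ (2 * k) := Real.one_le_rpow (by linarith) (by linarith)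
    linarith
  · have h1 : 1 ≤ (a + 1) ^ (2 * k) := Real.one_le_rpow (by linarith) (by linarith)
    have h2 : (r + 1) ^ (1 - 2 * s) ≤ (a + 1) ^ (1 - 2 * s) :=
      Real.rpow_le_rpow_of_nonpos (by linarith) (by linarith) (by linarith)
    linarith

theorem radialWeightDeriv_ge (hk : 0 < k) (hs : 1 / 2 < s) (hr : 0 ≤ r) :
    min (2 * k) (2 * s - 1) * (r + 1) ^ (-(2 * s)) ≤ radialWeightDeriv k s a r := by
  unfold radialWeightDeriv
  split_ifs
  · have : (r + 1) ^ (-(2 * s)) ≤ (r + 1) ^ (2 * k - 1) :=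
      Real.rpow_le_rpow_of_exponent_le (by linarith) (by linarith)
    have := min_le_left (2 * k) (2 * s - 1)
    gcongr
  · have := min_le_right (2 * k) (2 * s - 1)
    gcongr

theorem phiDeriv_nonneg (hk : 0 < k) (hτ : 0 ≤ τ) (hr : 0 ≤ r) : 0 ≤ phiDeriv k τ a r := by
  unfold phiDeriv
  split_ifs with h
  · have : (a + 1) ^ (-k) ≤ (r + 1) ^ (-k) :=
      Real.rpow_le_rpow_of_nonpos (by linarith) (by linarith) (by linarith)
    have : 0 ≤ (r + 1) ^ (-k) - (a + 1) ^ (-k) := by linarith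
    positivity
  · exact le_rfl

theorem phiDeriv_le (hk : 0 < k) (hτ : 0 ≤ τ) (ha : 0 ≤ a) (hr : 0 ≤ r) :
    phiDeriv k τ a r ≤ τ := by
  unfold phiDeriv
  split_ifs with h
  · have h1 : (r + 1) ^ (-k) ≤ 1 :=
      Real.rpow_le_one_of_one_le_of_nonpos (by linarith) (by linarith)
    have h2 : 0 ≤ (a + 1) ^ (-k) := by positivity
    nlinarith
  · exact hτ

theorem radialWeightDeriv_le (hk : 0 < k) (hk4 : k ≤ 1 / 4) (hs : 1 / 2 < s) (hs1 : s ≤ 1)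
    (hr : 0 ≤ r) : radialWeightDeriv k s a r ≤ 1 := by
  unfold radialWeightDeriv
  split_ifs
  · have : (r + 1) ^ (2 * k - 1) ≤ 1 :=
      Real.rpow_le_one_of_one_le_of_nonpos (by linarith) (by linarith)
    nlinarith
  · have : (r + 1) ^ (-(2 * s)) ≤ 1 :=
      Real.rpow_le_one_of_one_le_of_nonpos (by linarith) (by linarith)
    nlinarith

theorem abs_phiDeriv₂_le (hk : 0 < k) (hτ : 0 ≤ τ) (hr : 0 ≤ r) :
    |phiDeriv₂ k τ a r| ≤ k * τ := by
  unfold phiDeriv₂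
  split_ifs
  · have : (r + 1) ^ (-k - 1) ≤ 1 :=
      Real.rpow_le_one_of_one_le_of_nonpos (by linarith) (by linarith)
    rw [abs_neg, abs_of_nonneg (by positivity)]
    exact mul_le_of_le_one_right (by positivity) this
  · simpa using by positivity

/-- The weight grows at most like the square of the radius, which makes the angular part of the
energy flux nonnegative. -/
theorem mul_radialWeightDeriv_le (hk : 0 < k) (hk2 : 2 * k ≤ 1) (hs : 1 / 2 < s)
    (hs1 : s ≤ 1) (ha : 0 ≤ a) (hr : 0 ≤ r) (hak : 2 ≤ (a + 1) ^ (2 * k)) :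
    r * radialWeightDeriv k s a r ≤ 2 * radialWeight k s a r := by
  unfold radialWeight radialWeightDeriv
  have hy : 0 < r + 1 := by linarith
  split_ifs with h
  · have h1 := rpow_one_add_le_one_add_mul_self (s := -(r / (r + 1))) (p := 2 * k)
      (by rw [neg_le_neg_iff, div_le_one hy]; linarith) (by linarith) hk2
    have h2 : 1 + -(r / (r + 1)) = (r + 1)⁻¹ := by field_simp; ring
    rw [h2, Real.inv_rpow hy.le] at h1
    have h3 : 0 < (r + 1) ^ (2 * k) := by positivity
    have h4 : (r + 1) ^ (2 * k - 1) = (r + 1) ^ (2 * k) / (r + 1) := by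
      rw [Real.rpow_sub hy, Real.rpow_one]
    have h5 : 1 ≤ (r + 1) ^ (2 * k) * (1 + 2 * k * -(r / (r + 1))) := by
      have := mul_le_mul_of_nonneg_left h1 h3.le
      rwa [mul_inv_cancel₀ h3.ne'] at this
    have h6 : r * (2 * k * (r + 1) ^ (2 * k - 1)) = (r + 1) ^ (2 * k) * (2 * k * (r / (r + 1))) := by
      rw [h4]; ring
    have h7 : 1 ≤ (r + 1) ^ (2 * k) := Real.one_le_rpow (by linarith) (by linarith)
    rw [h6]
    nlinarith
  · have h2 : (r + 1) ^ (1 - 2 * s) ≤ (a + 1) ^ (1 - 2 * s) :=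
      Real.rpow_le_rpow_of_nonpos (by linarith) (by linarith) (by linarith)
    have h1 : (r + 1) ^ (1 - 2 * s) ≤ 1 :=
      Real.rpow_le_one_of_one_le_of_nonpos (by linarith) (by linarith)
    have h3 : (r + 1) ^ (1 - 2 * s) = (r + 1) * (r + 1) ^ (-(2 * s)) := by
      rw [show 1 - 2 * s = 1 + -(2 * s) by ring, Real.rpow_add hy, Real.rpow_one]
    have h4 : 0 < (r + 1) ^ (-(2 * s)) := by positivity
    have h5 : r * ((2 * s - 1) * (r + 1) ^ (-(2 * s))) ≤ (r + 1) ^ (1 - 2 * s) := by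
      rw [h3]; nlinarith [mul_nonneg hr h4.le]
    linarith

end Weights

theorem quadratic_form_nonneg {D t c X Y : ℝ} (hD : 0 ≤ D) (ht : 0 ≤ t)
    (h : 2 * c ^ 2 ≤ D * t) : 0 ≤ D / 2 * X ^ 2 + 2 * c * Y * X + t * Y ^ 2 := by
  rcases hD.eq_or_lt with rfl | hD
  · have : c = 0 := by nlinarith [sq_nonneg c]
    subst this
    have : 0 ≤ t * Y ^ 2 := by positivity
    linarith
  · have h2 : 0 ≤ 2 * D * (D / 2 * X ^ 2 + 2 * c * Y * X + t * Y ^ 2) := by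
      nlinarith [sq_nonneg (D * X + 2 * c * Y), mul_nonneg (sub_nonneg.2 h) (sq_nonneg Y)]
    exact nonneg_of_mul_nonneg_right h2 (by positivity)

set_option maxHeartbeats 2000000 in
/-- The algebraic form of the positivity of the weights in the region where the phase is active,
with `A = y ^ k`, `B = b ^ k` and `Z` the decay of the potential. -/
theorem weight_positivity_algebraic {E k τ C P v y A B Z : ℝ} (hE : 0 < E) (hk : 0 < k)
    (hk4 : k ≤ 1 / 4) (hτ : 1 ≤ τ) (hC : 0 < C) (hy : 1 ≤ y) (hA : 1 ≤ A) (hAB : A ≤ B)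
    (hA3 : A ^ 3 ≤ y) (hZ0 : 0 ≤ Z) (hZ : A ^ 4 * y * Z ≤ 1) (h1 : 8 * C ≤ k * τ ^ 2)
    (h3 : τ ^ 2 / B ≤ E / 16)
    (hv : (v ≤ E / 2 ∧ C * y * Z ≤ E * k / 8) ∨
      (v ≤ P ∧ 16 * P * A ^ 4 ≤ τ ^ 2 ∧ 2 * A ≤ B)) :
    ∃ t : ℝ, 0 ≤ t ∧
      2 * ((A ^ 2 - 1) * (-(k * τ * (1 / (A * y))))) ^ 2 ≤
        (2 * k * (A ^ 2 / y) + 4 * (τ * (1 / A - 1 / B)) * (A ^ 2 - 1)) * t ∧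
      E / 8 * (2 * k * (A ^ 2 / y)) + t ≤
        2 * k * (A ^ 2 / y) * (E - v) + (2 * k * (A ^ 2 / y) * (τ * (1 / A - 1 / B)) ^ 2
          + 2 * (A ^ 2 - 1) * (τ * (1 / A - 1 / B)) * (-(k * τ * (1 / (A * y)))))
          - C * (A ^ 2 - 1) * Z := by
  have hy0 : 0 < y := by linarith
  have hA0 : 0 < A := by linarith
  have hB0 : 0 < B := by linarith
  have hτ0 : 0 < τ := by linarith
  have hA1 : 0 ≤ A ^ 2 - 1 := sub_nonneg.2 (one_le_pow₀ hA)
  obtain ⟨ρ, hρ⟩ : ∃ ρ, ρ = A / B := ⟨_, rfl⟩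
  have hB : 1 / B = ρ / A := by rw [hρ]; field_simp
  have hρ0 : 0 < ρ := by rw [hρ]; positivity
  have hρ1 : ρ ≤ 1 := by rw [hρ, div_le_one hB0]; exact hAB
  have hτρ : τ ^ 2 * ρ ≤ E / 16 * A ^ 2 := by
    have : τ ^ 2 * ρ = τ ^ 2 / B * A := by rw [hρ]; ring
    rw [this]
    calc τ ^ 2 / B * A ≤ E / 16 * A := by gcongr
      _ ≤ E / 16 * A ^ 2 := by gcongr; exact le_self_pow₀ hA two_ne_zero
  obtain ⟨S, hS⟩ : ∃ S, S = 1 / A ^ 2 := ⟨_, rfl⟩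
  have hS0 : 0 < S := by rw [hS]; positivity
  have hS1 : S ≤ 1 := by rw [hS, div_le_one (by positivity)]; exact one_le_pow₀ hA
  have hAS : A ^ 2 * S = 1 := by rw [hS]; field_simp
  have hmain : 2 * k * (A ^ 2 / y) * (τ * (1 / A - 1 / B)) ^ 2
          + 2 * (A ^ 2 - 1) * (τ * (1 / A - 1 / B)) * (-(k * τ * (1 / (A * y))))
        = k / y * (2 * τ ^ 2 * ((1 - ρ) * (S - ρ))) := by
    rw [hB, hS]; field_simp; ring
  have hky : 0 < k / y := by positivity
  have hCZ : C * (A ^ 2 - 1) * Z ≤ k / y * (A ^ 2 * (C * y * Z) / k) := by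
    have : k / y * (A ^ 2 * (C * y * Z) / k) = C * A ^ 2 * Z := by field_simp
    rw [this]
    gcongr; linarith
  rw [hmain]
  by_cases hcase : ρ ≤ 1 / 2
  · refine ⟨k ^ 2 * τ * A / y ^ 2, by positivity, ?_, ?_⟩
    · have e1 : 2 * ((A ^ 2 - 1) * (-(k * τ * (1 / (A * y))))) ^ 2
          = (k ^ 2 * τ ^ 2 / y ^ 2) * (A ^ 2 - 1) * (2 * ((A ^ 2 - 1) / A ^ 2)) := by
        field_simp
      have e2 : (4 * (τ * (1 / A - 1 / B)) * (A ^ 2 - 1)) * (k ^ 2 * τ * A / y ^ 2)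
          = (k ^ 2 * τ ^ 2 / y ^ 2) * (A ^ 2 - 1) * (4 * (1 - ρ)) := by
        rw [hB]; field_simp
      have e3 : (A ^ 2 - 1) / A ^ 2 ≤ 1 := by rw [div_le_one (by positivity)]; linarith
      rw [add_mul, e1, e2]
      have : (k ^ 2 * τ ^ 2 / y ^ 2) * (A ^ 2 - 1) * (2 * ((A ^ 2 - 1) / A ^ 2)) ≤
          (k ^ 2 * τ ^ 2 / y ^ 2) * (A ^ 2 - 1) * (4 * (1 - ρ)) := by
        gcongr ?_ * ?_
        linarith
      have h0 : 0 ≤ 2 * k * (A ^ 2 / y) * (k ^ 2 * τ * A / y ^ 2) := by positivity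
      linarith
    · have e1 : E / 8 * (2 * k * (A ^ 2 / y)) + k ^ 2 * τ * A / y ^ 2
          = k / y * (E / 4 * A ^ 2 + k * τ * (A / y)) := by field_simp; ring
      have e2 : 2 * k * (A ^ 2 / y) * (E - v) = k / y * (2 * A ^ 2 * (E - v)) := by field_simp
      have hAy : A / y ≤ S := by
        rw [hS, div_le_div_iff₀ hy0 (by positivity)]; linarith
      have e3 : k * τ * (A / y) ≤ τ ^ 2 * S / 4 := by
        calc k * τ * (A / y) ≤ 1 / 4 * τ * S := by gcongr
          _ ≤ 1 / 4 * τ ^ 2 * S := by gcongr; exact le_self_pow₀ hτ two_ne_zero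
          _ = _ := by ring
      have e4 : τ ^ 2 * S / 4 - τ ^ 2 * ρ ≤ τ ^ 2 * ((1 - ρ) * (S - ρ)) := by
        have : S / 4 - ρ ≤ (1 - ρ) * (S - ρ) := by
          linarith [mul_nonneg hS0.le (show 0 ≤ 3 / 4 - ρ by linarith), sq_nonneg ρ]
        linarith [mul_le_mul_of_nonneg_left this (sq_nonneg τ)]
      have e5 : A ^ 2 * (C * y * Z) / k ≤ τ ^ 2 * S / 8 := by
        rw [div_le_iff₀ hk]
        have h5 : A ^ 2 * (y * Z) ≤ S := by
          have : A ^ 2 * (y * Z) = S * (A ^ 4 * y * Z) := by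
            rw [show A ^ 4 = A ^ 2 * A ^ 2 by ring]
            linear_combination (-(A ^ 2 * y * Z)) * hAS
          rw [this]; exact mul_le_of_le_one_right hS0.le hZ
        calc A ^ 2 * (C * y * Z) = C * (A ^ 2 * (y * Z)) := by ring
          _ ≤ C * S := by gcongr
          _ ≤ (k * τ ^ 2 / 8) * S := by gcongr; linarith
          _ = _ := by ring
      rw [e1, e2]
      have : E / 4 * A ^ 2 + k * τ * (A / y) ≤ 2 * A ^ 2 * (E - v)
          + 2 * τ ^ 2 * ((1 - ρ) * (S - ρ)) - A ^ 2 * (C * y * Z) / k := by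
        have hτS : 0 < τ ^ 2 * S := by positivity
        have hEA : 0 < E * A ^ 2 := by positivity
        rcases hv with ⟨hv, -⟩ | ⟨hv, hP, -⟩
        · have : A ^ 2 * v ≤ A ^ 2 * (E / 2) := by gcongr
          linarith
        · have h6 : A ^ 2 * v ≤ τ ^ 2 * S / 16 := by
            calc A ^ 2 * v ≤ A ^ 2 * P := by gcongr
              _ = S * (P * A ^ 4) := by
                rw [show A ^ 4 = A ^ 2 * A ^ 2 by ring]
                linear_combination (-(A ^ 2 * P)) * hAS
              _ ≤ S * (τ ^ 2 / 16) := by gcongr; linarith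
              _ = _ := by ring
          linarith
      linarith [mul_le_mul_of_nonneg_left this hky.le]
  · push Not at hcase
    have hv' : v ≤ E / 2 ∧ C * y * Z ≤ E * k / 8 := by
      rcases hv with h | ⟨-, -, h⟩
      · exact h
      · exfalso
        rw [hρ, lt_div_iff₀ hB0] at hcase
        linarith
    refine ⟨k * τ ^ 2 / y, by positivity, ?_, ?_⟩
    · have e1 : 2 * ((A ^ 2 - 1) * (-(k * τ * (1 / (A * y))))) ^ 2
          = 2 * (k ^ 2 * τ ^ 2 / (A ^ 2 * y ^ 2)) * (A ^ 2 - 1) ^ 2 := by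
        field_simp
      have e2 : 2 * k * (A ^ 2 / y) * (k * τ ^ 2 / y)
          = 2 * (k ^ 2 * τ ^ 2 / (A ^ 2 * y ^ 2)) * (A ^ 2) ^ 2 := by
        field_simp
      have e3 : 0 ≤ 4 * (τ * (1 / A - 1 / B)) * (A ^ 2 - 1) := by
        have : 0 ≤ 1 / A - 1 / B := sub_nonneg.2 (one_div_le_one_div_of_le hA0 hAB)
        positivity
      rw [add_mul, e1, e2]
      have : 2 * (k ^ 2 * τ ^ 2 / (A ^ 2 * y ^ 2)) * (A ^ 2 - 1) ^ 2 ≤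
          2 * (k ^ 2 * τ ^ 2 / (A ^ 2 * y ^ 2)) * (A ^ 2) ^ 2 := by
        gcongr; linarith
      have h0 : 0 ≤ 4 * (τ * (1 / A - 1 / B)) * (A ^ 2 - 1) * (k * τ ^ 2 / y) := by positivity
      linarith
    · have e1 : E / 8 * (2 * k * (A ^ 2 / y)) + k * τ ^ 2 / y
          = k / y * (E / 4 * A ^ 2 + τ ^ 2) := by field_simp; ring
      have e2 : 2 * k * (A ^ 2 / y) * (E - v) = k / y * (2 * A ^ 2 * (E - v)) := by field_simp
      have e3 : τ ^ 2 ≤ E / 8 * A ^ 2 := by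
        linarith [mul_nonneg (sq_nonneg τ) (show 0 ≤ ρ - 1 / 2 by linarith)]
      have e4 : - (τ ^ 2 * ρ) ≤ τ ^ 2 * ((1 - ρ) * (S - ρ)) := by
        have : - ρ ≤ (1 - ρ) * (S - ρ) := by
          linarith [mul_nonneg hS0.le (sub_nonneg.2 hρ1), sq_nonneg ρ]
        linarith [mul_le_mul_of_nonneg_left this (sq_nonneg τ)]
      have e5 : A ^ 2 * (C * y * Z) / k ≤ A ^ 2 * E / 8 := by
        rw [div_le_iff₀ hk]
        linarith [mul_le_mul_of_nonneg_left hv'.2 (sq_nonneg A)]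
      rw [e1, e2]
      have : E / 4 * A ^ 2 + τ ^ 2 ≤ 2 * A ^ 2 * (E - v)
          + 2 * τ ^ 2 * ((1 - ρ) * (S - ρ)) - A ^ 2 * (C * y * Z) / k := by
        have hEA : 0 < E * A ^ 2 := by positivity
        have : A ^ 2 * v ≤ A ^ 2 * (E / 2) := by gcongr; exact hv'.1
        linarith
      linarith [mul_le_mul_of_nonneg_left this hky.le]

/-- Positivity of the weights under quantitative largeness conditions on `τ` and `a`. -/
theorem weight_positivity {E k s τ a C P v r Y₁ γ : ℝ} (hE : 0 < E) (hk : 0 < k)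
    (hk4 : k ≤ 1 / 4) (hs : 1 / 2 < s) (hτ : 1 ≤ τ) (ha : 0 ≤ a) (hC : 0 < C) (hr : 0 ≤ r)
    (hγ1 : 1 + 4 * k ≤ γ) (hγ : 2 * k + 2 * s < γ) (hP : 0 ≤ P) (hY₁ : 1 ≤ Y₁)
    (hvP : v ≤ P) (hv : Y₁ ≤ r + 1 → v ≤ E / 2)
    (hCY : C * Y₁ ^ (1 - γ) ≤ E * k / 8)
    (h1 : 8 * C ≤ k * τ ^ 2) (h2 : 16 * P * (Y₁ ^ k) ^ 4 ≤ τ ^ 2)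
    (h3 : τ ^ 2 / (a + 1) ^ k ≤ E / 16) (h4 : 2 * Y₁ ^ k ≤ (a + 1) ^ k)
    (h5 : C * (a + 1) ^ (2 * k + 2 * s - γ) ≤ E / 8 * (2 * s - 1)) (h6 : Y₁ ≤ a + 1) :
    ∃ t : ℝ, 0 ≤ t ∧
      2 * (radialWeight k s a r * phiDeriv₂ k τ a r) ^ 2 ≤
        (radialWeightDeriv k s a r + 4 * phiDeriv k τ a r * radialWeight k s a r) * t ∧
      E / 8 * radialWeightDeriv k s a r + t ≤
        radialWeightDeriv k s a r * (E - v)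
          + (radialWeightDeriv k s a r * phiDeriv k τ a r ^ 2
            + 2 * radialWeight k s a r * phiDeriv k τ a r * phiDeriv₂ k τ a r)
          - C * radialWeight k s a r * (r + 1) ^ (-γ) := by
  have hy : 0 < r + 1 := by linarith
  have hb : 0 < a + 1 := by linarith
  by_cases hra : r ≤ a
  · have hA2 : ∀ x : ℝ, 0 < x → x ^ (2 * k) = (x ^ k) ^ 2 := fun x hx => by
      rw [mul_comm, Real.rpow_mul hx.le]; norm_num
    have e1 : (r + 1) ^ (2 * k - 1) = ((r + 1) ^ k) ^ 2 / (r + 1) := by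
      rw [Real.rpow_sub hy, Real.rpow_one, hA2 _ hy]
    have e2 : ∀ x : ℝ, 0 < x → x ^ (-k) = 1 / x ^ k := fun x hx => by
      rw [Real.rpow_neg hx.le, one_div]
    have e3 : (r + 1) ^ (-k - 1) = 1 / ((r + 1) ^ k * (r + 1)) := by
      rw [Real.rpow_sub hy, Real.rpow_one, e2 _ hy, div_div]
    have eC : C * (r + 1) * (r + 1) ^ (-γ) = C * (r + 1) ^ (1 - γ) := by
      rw [show 1 - γ = 1 + -γ by ring, Real.rpow_add hy, Real.rpow_one]; ring
    have key := weight_positivity_algebraic (E := E) (k := k) (τ := τ) (C := C) (P := P) (v := v)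
      (y := r + 1) (A := (r + 1) ^ k) (B := (a + 1) ^ k) (Z := (r + 1) ^ (-γ)) hE hk hk4 hτ hC
      (by linarith) (Real.one_le_rpow (by linarith) hk.le) (by gcongr)
      (by
        rw [← Real.rpow_natCast, ← Real.rpow_mul hy.le]
        calc (r + 1) ^ (k * (3 : ℕ)) ≤ (r + 1) ^ (1 : ℝ) :=
              Real.rpow_le_rpow_of_exponent_le (by linarith) (by push_cast; linarith)
          _ = r + 1 := Real.rpow_one _)
      (by positivity)
      (by
        rw [← Real.rpow_natCast, ← Real.rpow_mul hy.le]
        calc (r + 1) ^ (k * (4 : ℕ)) * (r + 1) * (r + 1) ^ (-γ)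
            = (r + 1) ^ (k * (4 : ℕ)) * (r + 1) ^ (1 : ℝ) * (r + 1) ^ (-γ) := by
              rw [Real.rpow_one]
          _ = (r + 1) ^ (k * (4 : ℕ) + 1 + -γ) := by
              rw [Real.rpow_add hy, Real.rpow_add hy]
          _ ≤ 1 := Real.rpow_le_one_of_one_le_of_nonpos (by linarith)
              (by push_cast; linarith))
      h1 h3
      (by
        rcases le_total Y₁ (r + 1) with h | h
        · left
          refine ⟨hv h, ?_⟩
          rw [eC]
          refine le_trans ?_ hCY
          have : (r + 1) ^ (1 - γ) ≤ Y₁ ^ (1 - γ) :=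
            Real.rpow_le_rpow_of_nonpos (by linarith) h (by linarith)
          gcongr
        · right
          have h7 : (r + 1) ^ k ≤ Y₁ ^ k := by gcongr
          refine ⟨hvP, le_trans ?_ h2, by linarith⟩
          gcongr)
    simp only [radialWeight, radialWeightDeriv, phiDeriv, phiDeriv₂, if_pos hra, e1, e3, hA2 _ hy,
      e2 _ hy, e2 _ hb]
    exact key
  · have hab : a + 1 ≤ r + 1 := by linarith
    have hw := radialWeight_le (s := s) hk hs ha hr
    have h0 : 0 < 2 * s - 1 := by linarith
    refine ⟨0, le_rfl, ?_, ?_⟩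
    · simp [phiDeriv₂, if_neg hra]
    · have hv2 : v ≤ E / 2 := hv (h6.trans hab)
      have hz : 0 ≤ (r + 1) ^ (-γ) := by positivity
      have e1 : (r + 1) ^ (-γ) = (r + 1) ^ (-(2 * s)) * (r + 1) ^ (2 * s - γ) := by
        rw [← Real.rpow_add hy]; ring_nf
      have hz2 : (r + 1) ^ (2 * s - γ) ≤ (a + 1) ^ (2 * s - γ) :=
        Real.rpow_le_rpow_of_nonpos hb hab (by linarith)
      have hz3 : 0 ≤ (r + 1) ^ (-(2 * s)) := by positivity
      have e2 : (a + 1) ^ (2 * k + 2 * s - γ) = (a + 1) ^ (2 * k) * (a + 1) ^ (2 * s - γ) := by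
        rw [← Real.rpow_add hb]; ring_nf
      have h7 : C * radialWeight k s a r * (r + 1) ^ (-γ) ≤
          E / 8 * ((2 * s - 1) * (r + 1) ^ (-(2 * s))) := by
        calc C * radialWeight k s a r * (r + 1) ^ (-γ)
            ≤ C * (a + 1) ^ (2 * k) * ((r + 1) ^ (-(2 * s)) * (a + 1) ^ (2 * s - γ)) := by
              rw [e1]; gcongr
          _ = C * (a + 1) ^ (2 * k + 2 * s - γ) * (r + 1) ^ (-(2 * s)) := by rw [e2]; ring
          _ ≤ E / 8 * (2 * s - 1) * (r + 1) ^ (-(2 * s)) := by gcongr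
          _ = _ := by ring
      have hd : radialWeightDeriv k s a r = (2 * s - 1) * (r + 1) ^ (-(2 * s)) := by
        simp [radialWeightDeriv, hra]
      have hq : phiDeriv k τ a r = 0 := by simp [phiDeriv, hra]
      rw [hd, hq]
      have h8 : 0 ≤ (2 * s - 1) * (r + 1) ^ (-(2 * s)) := by positivity
      have h9 : (2 * s - 1) * (r + 1) ^ (-(2 * s)) * v ≤
          (2 * s - 1) * (r + 1) ^ (-(2 * s)) * (E / 2) := by gcongr
      have h10 : 0 ≤ E * ((2 * s - 1) * (r + 1) ^ (-(2 * s))) := by positivity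
      linarith

/-- The existence of a parameter `τ` for which the quadratic form governing the energy identity
dominates the weighted energy. -/
theorem exists_carleman_parameter {E r₀ C₂ β k s ℓ : ℝ} {p : ℝ → ℝ} (hE : 0 < E) (hr₀ : 0 < r₀)
    (hp_pos : ∀ r : ℝ, 0 ≤ r → 0 < p r)
    (hp_mono : ∀ r r' : ℝ, 0 ≤ r → r ≤ r' → p r' ≤ p r)
    (hp_lim : Filter.Tendsto p Filter.atTop (nhds 0)) (hC₂ : 0 < C₂)
    (hk : 0 < k) (hk4 : k ≤ 1 / 4) (hkβ : 4 * k ≤ β - 1) (hs : 1 / 2 < s) (hs1 : s < 3 / 4)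
    (hℓ1 : k * ℓ > 2) (hβ : 2 * k + 2 * s < β) :
    ∃ τ : ℝ, 1 ≤ τ ∧ ∀ a, a = τ ^ ℓ → ∀ r, r₀ ≤ r →
      r * radialWeightDeriv k s a r ≤ 2 * radialWeight k s a r ∧
      ∀ v ≤ p r, ∀ h, 0 < h → h ≤ 1 → ∀ X Y : ℝ,
        radialWeightDeriv k s a r / 2 * X ^ 2 + E / 8 * radialWeightDeriv k s a r * Y ^ 2 ≤
          (radialWeightDeriv k s a r + 4 * phiDeriv k τ a r * radialWeight k s a r / h) * X ^ 2
          + (radialWeightDeriv k s a r * (E + phiDeriv k τ a r ^ 2)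
            + 2 * radialWeight k s a r * phiDeriv k τ a r * phiDeriv₂ k τ a r
            - h ^ 2 / (4 * r ^ 2) * (2 * radialWeight k s a r / r - radialWeightDeriv k s a r)
            - radialWeightDeriv k s a r * v - C₂ * (r + 1) ^ (-β) * radialWeight k s a r) * Y ^ 2
          + 2 * radialWeight k s a r * phiDeriv₂ k τ a r * Y * X := by
  have hℓ : 0 < ℓ := by
    by_contra! h
    nlinarith
  obtain ⟨γ, hγ⟩ : ∃ γ, γ = min β 3 := ⟨_, rfl⟩
  have hγβ : γ ≤ β := hγ ▸ min_le_left _ _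
  have hγ3 : γ ≤ 3 := hγ ▸ min_le_right _ _
  have hγ1 : 1 + 4 * k ≤ γ := by rw [hγ]; exact le_min (by linarith) (by linarith)
  have hγ2 : 2 * k + 2 * s < γ := by rw [hγ]; exact lt_min hβ (by linarith)
  obtain ⟨K, hK⟩ : ∃ K, K = ((r₀ + 1) / r₀) ^ 3 / 2 := ⟨_, rfl⟩
  have hK0 : 0 < K := by rw [hK]; positivity
  obtain ⟨C, hC⟩ : ∃ C, C = C₂ + K := ⟨_, rfl⟩
  have hC0 : 0 < C := by rw [hC]; positivity
  obtain ⟨Y₁, hY1, hYp, hYC⟩ : ∃ Y₁ : ℝ, 1 ≤ Y₁ ∧ p (Y₁ - 1) ≤ E / 2 ∧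
      C * Y₁ ^ (1 - γ) ≤ E * k / 8 := by
    have t1 : Filter.Tendsto (fun Y : ℝ => p (Y - 1)) Filter.atTop (nhds 0) :=
      hp_lim.comp (Filter.tendsto_atTop_add_const_right _ (-1) Filter.tendsto_id)
    have t2 : Filter.Tendsto (fun Y : ℝ => C * Y ^ (1 - γ)) Filter.atTop (nhds (C * 0)) := by
      have := tendsto_rpow_neg_atTop (show 0 < γ - 1 by linarith)
      rw [show -(γ - 1) = 1 - γ by ring] at this
      exact this.const_mul C
    rw [mul_zero] at t2
    obtain ⟨Y, h1, h2, h3⟩ := ((Filter.eventually_ge_atTop (1 : ℝ)).and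
      ((t1.eventually_le_const (show 0 < E / 2 by positivity)).and
        (t2.eventually_le_const (show 0 < E * k / 8 by positivity)))).exists
    exact ⟨Y, h1, h2, h3⟩
  have tb : Filter.Tendsto (fun τ : ℝ => τ ^ ℓ + 1) Filter.atTop Filter.atTop :=
    Filter.tendsto_atTop_add_const_right _ 1 (tendsto_rpow_atTop hℓ)
  have tbk : Filter.Tendsto (fun τ : ℝ => (τ ^ ℓ + 1) ^ k) Filter.atTop Filter.atTop :=
    (tendsto_rpow_atTop hk).comp tb
  have tsq : Filter.Tendsto (fun τ : ℝ => τ ^ 2) Filter.atTop Filter.atTop :=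
    Filter.tendsto_pow_atTop two_ne_zero
  have c1 := (tsq.const_mul_atTop hk).eventually_ge_atTop (8 * C)
  have c2 := tsq.eventually_ge_atTop (16 * p 0 * (Y₁ ^ k) ^ 4)
  have c3 : ∀ᶠ τ : ℝ in Filter.atTop, τ ^ 2 / (τ ^ ℓ + 1) ^ k ≤ E / 16 := by
    have t := tendsto_rpow_neg_atTop (show 0 < k * ℓ - 2 by linarith)
    filter_upwards [t.eventually_le_const (show 0 < E / 16 by positivity),
      Filter.eventually_gt_atTop (0 : ℝ)] with τ h1 h2
    refine le_trans ?_ h1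
    calc τ ^ 2 / (τ ^ ℓ + 1) ^ k ≤ τ ^ 2 / (τ ^ ℓ) ^ k := by
          gcongr; linarith
      _ = τ ^ (-(k * ℓ - 2)) := by
          rw [← Real.rpow_mul h2.le, show -(k * ℓ - 2) = (2 : ℕ) - ℓ * k by push_cast; ring,
            Real.rpow_sub h2, Real.rpow_natCast]
  have c4 := tbk.eventually_ge_atTop (2 * Y₁ ^ k)
  have c5 : ∀ᶠ τ : ℝ in Filter.atTop,
      C * (τ ^ ℓ + 1) ^ (2 * k + 2 * s - γ) ≤ E / 8 * (2 * s - 1) := by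
    have t := ((tendsto_rpow_neg_atTop (show 0 < γ - (2 * k + 2 * s) by linarith)).comp
      tb).const_mul C
    rw [mul_zero] at t
    have := t.eventually_le_const (show 0 < E / 8 * (2 * s - 1) by
      have : 0 < 2 * s - 1 := by linarith
      positivity)
    filter_upwards [this] with τ h1
    rwa [Function.comp_apply, show -(γ - (2 * k + 2 * s)) = 2 * k + 2 * s - γ by ring] at h1
  have c6 := tb.eventually_ge_atTop Y₁
  obtain ⟨τ, hτ, h1, h2, h3, h4, h5, h6⟩ := ((Filter.eventually_ge_atTop (1 : ℝ)).and
    (c1.and (c2.and (c3.and (c4.and (c5.and c6)))))).exists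
  refine ⟨τ, hτ, ?_⟩
  rintro a rfl r hr
  have hr0 : 0 < r := hr₀.trans_le hr
  have ha : 0 ≤ τ ^ ℓ := by positivity
  have hm := radialWeight_nonneg (s := s) hk hs ha hr0.le
  have hm' := radialWeightDeriv_nonneg (a := τ ^ ℓ) hk hs hr0.le
  have hq := phiDeriv_nonneg (a := τ ^ ℓ) hk (zero_le_one.trans hτ) hr0.le
  have hcone : r * radialWeightDeriv k s (τ ^ ℓ) r ≤ 2 * radialWeight k s (τ ^ ℓ) r := by
    refine mul_radialWeightDeriv_le hk (by linarith) hs (by linarith) ha hr0.le ?_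
    have h7 : 1 ≤ Y₁ ^ k := Real.one_le_rpow hY1 hk.le
    rw [mul_comm, Real.rpow_mul (by linarith), Real.rpow_two]
    nlinarith
  refine ⟨hcone, ?_⟩
  intro v hv h hh hh1 X Y
  obtain ⟨t, ht, hD, hN⟩ := weight_positivity (r := r) (v := v) (P := p 0) (Y₁ := Y₁) (γ := γ)
    (C := C) hE hk hk4 hs hτ ha hC0 hr0.le hγ1 hγ2 (hp_pos 0 le_rfl).le hY1
    (hv.trans (hp_mono 0 r le_rfl hr0.le))
    (fun hY => hv.trans ((hp_mono (Y₁ - 1) r (by linarith) (by linarith)).trans hYp))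
    hYC h1 h2 h3 h4 h5 h6
  have hZ0 : 0 ≤ (r + 1) ^ (-γ) := by positivity
  have hZ1 : (r + 1) ^ (-β) ≤ (r + 1) ^ (-γ) :=
    Real.rpow_le_rpow_of_exponent_le (by linarith) (by linarith)
  have hcent : h ^ 2 / (4 * r ^ 2) * (2 * radialWeight k s (τ ^ ℓ) r / r
      - radialWeightDeriv k s (τ ^ ℓ) r) ≤ K * (r + 1) ^ (-γ) * radialWeight k s (τ ^ ℓ) r := by
    have g1 : 1 / (2 * r ^ 3) ≤ K * (r + 1) ^ (-γ) := by
      have g2 : (r + 1) ^ (-(3 : ℝ)) ≤ (r + 1) ^ (-γ) :=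
        Real.rpow_le_rpow_of_exponent_le (by linarith) (by linarith)
      have g3 : (r + 1) ^ (-(3 : ℝ)) = 1 / (r + 1) ^ 3 := by
        rw [Real.rpow_neg (by linarith), one_div, ← Real.rpow_natCast]; norm_num
      have g4 : 1 / r ≤ (r₀ + 1) / r₀ * (1 / (r + 1)) := by
        rw [div_mul_div_comm, div_le_div_iff₀ hr0 (by positivity)]
        nlinarith
      calc 1 / (2 * r ^ 3) = (1 / r) ^ 3 / 2 := by field_simp
        _ ≤ ((r₀ + 1) / r₀ * (1 / (r + 1))) ^ 3 / 2 := by gcongr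
        _ = K * (1 / (r + 1) ^ 3) := by rw [hK]; field_simp
        _ ≤ K * (r + 1) ^ (-γ) := by rw [← g3]; gcongr
    calc h ^ 2 / (4 * r ^ 2) * (2 * radialWeight k s (τ ^ ℓ) r / r
          - radialWeightDeriv k s (τ ^ ℓ) r)
        ≤ 1 / (4 * r ^ 2) * (2 * radialWeight k s (τ ^ ℓ) r / r) := by
          gcongr
          · rw [sub_nonneg, le_div_iff₀ hr0, mul_comm]; exact hcone
          · exact pow_le_one₀ hh.le hh1
          · linarith
      _ = 1 / (2 * r ^ 3) * radialWeight k s (τ ^ ℓ) r := by field_simp; norm_num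
      _ ≤ _ := by gcongr
  have hquad := quadratic_form_nonneg (X := X) (Y := Y) (by positivity) ht hD
  have hqh : 4 * phiDeriv k τ (τ ^ ℓ) r * radialWeight k s (τ ^ ℓ) r ≤
      4 * phiDeriv k τ (τ ^ ℓ) r * radialWeight k s (τ ^ ℓ) r / h := by
    rw [le_div_iff₀ hh]
    exact mul_le_of_le_one_right (by positivity) hh1
  have hpot : C₂ * (r + 1) ^ (-β) * radialWeight k s (τ ^ ℓ) r ≤
      C₂ * (r + 1) ^ (-γ) * radialWeight k s (τ ^ ℓ) r := by gcongr
  have hX := mul_le_mul_of_nonneg_right hqh (sq_nonneg X)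
  have hY : E / 8 * radialWeightDeriv k s (τ ^ ℓ) r + t ≤
      radialWeightDeriv k s (τ ^ ℓ) r * (E + phiDeriv k τ (τ ^ ℓ) r ^ 2)
            + 2 * radialWeight k s (τ ^ ℓ) r * phiDeriv k τ (τ ^ ℓ) r * phiDeriv₂ k τ (τ ^ ℓ) r
            - h ^ 2 / (4 * r ^ 2) * (2 * radialWeight k s (τ ^ ℓ) r / r
              - radialWeightDeriv k s (τ ^ ℓ) r)
            - radialWeightDeriv k s (τ ^ ℓ) r * v
            - C₂ * (r + 1) ^ (-β) * radialWeight k s (τ ^ ℓ) r := by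
    rw [hC] at hN
    linarith
  have hY2 := mul_le_mul_of_nonneg_right hY (sq_nonneg Y)
  linarith [mul_nonneg (mul_nonneg hq hm) (sq_nonneg X)]

/-- Measurable and bounded on a set. -/
def BoundedMeasurableOn {α : Type*} [MeasureSpace α] (F : α → ℝ) (S : Set α) : Prop :=
  AEStronglyMeasurable F (volume.restrict S) ∧ ∃ B, ∀ x ∈ S, |F x| ≤ B

namespace BoundedMeasurableOn

variable {α : Type*} [MeasureSpace α] {F G : α → ℝ} {S : Set α}

theorem add (hF : BoundedMeasurableOn F S) (hG : BoundedMeasurableOn G S) :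
    BoundedMeasurableOn (fun x => F x + G x) S := by
  obtain ⟨hFm, A, hA⟩ := hF
  obtain ⟨hGm, B, hB⟩ := hG
  exact ⟨hFm.add hGm, A + B, fun x hx => (abs_add_le _ _).trans (add_le_add (hA x hx) (hB x hx))⟩

theorem neg (hF : BoundedMeasurableOn F S) : BoundedMeasurableOn (fun x => -F x) S := by
  obtain ⟨hFm, A, hA⟩ := hF
  exact ⟨hFm.neg, A, fun x hx => by rw [abs_neg]; exact hA x hx⟩

theorem sub (hF : BoundedMeasurableOn F S) (hG : BoundedMeasurableOn G S) :
    BoundedMeasurableOn (fun x => F x - G x) S := by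
  simpa only [sub_eq_add_neg] using hF.add hG.neg

theorem mul (hF : BoundedMeasurableOn F S) (hG : BoundedMeasurableOn G S) :
    BoundedMeasurableOn (fun x => F x * G x) S := by
  obtain ⟨hFm, A, hA⟩ := hF
  obtain ⟨hGm, B, hB⟩ := hG
  refine ⟨hFm.mul hGm, A * B, fun x hx => ?_⟩
  rw [abs_mul]
  exact mul_le_mul (hA x hx) (hB x hx) (abs_nonneg _) ((abs_nonneg _).trans (hA x hx))

theorem const (c : ℝ) : BoundedMeasurableOn (fun _ : α => c) S :=
  ⟨aestronglyMeasurable_const, |c|, fun _ _ => le_rfl⟩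

theorem pow (hF : BoundedMeasurableOn F S) (n : ℕ) :
    BoundedMeasurableOn (fun x => F x ^ n) S := by
  induction n with
  | zero => simpa using const (S := S) 1
  | succ n ih => simpa only [pow_succ] using ih.mul hF

theorem integrableOn (hF : BoundedMeasurableOn F S) (hS : MeasurableSet S)
    (hv : volume S < ⊤) : IntegrableOn F S := by
  obtain ⟨hFm, A, hA⟩ := hF
  have : IsFiniteMeasure (volume.restrict S) := ⟨by simpa using hv⟩
  exact Integrable.of_bound hFm A ((ae_restrict_iff' hS).2 (Filter.Eventually.of_forall hA))

theorem of_continuousOn {α : Type*} [MeasureSpace α] [TopologicalSpace α] [OpensMeasurableSpace α]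
    [SecondCountableTopology α] {F : α → ℝ} {S : Set α} (hS : IsCompact S) (hm : MeasurableSet S)
    (hF : ContinuousOn F S) : BoundedMeasurableOn F S := by
  refine ⟨hF.aestronglyMeasurable hm, ?_⟩
  obtain ⟨B, hB⟩ := hS.exists_bound_of_continuousOn hF
  exact ⟨B, fun x hx => by simpa using hB x hx⟩

end BoundedMeasurableOn

/-- The rectangle of polar coordinates `r₀ ≤ r ≤ R`, `-π ≤ θ ≤ π`. -/
def polarRect (r₀ R : ℝ) : Set (ℝ × ℝ) := Icc r₀ R ×ˢ Icc (-Real.pi) Real.pi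

theorem isCompact_polarRect (r₀ R : ℝ) : IsCompact (polarRect r₀ R) :=
  isCompact_Icc.prod isCompact_Icc

theorem measurableSet_polarRect (r₀ R : ℝ) : MeasurableSet (polarRect r₀ R) :=
  measurableSet_Icc.prod measurableSet_Icc

theorem BoundedMeasurableOn.polarRect_integrable {r₀ R : ℝ} {F : ℝ × ℝ → ℝ}
    (hF : BoundedMeasurableOn F (polarRect r₀ R)) : IntegrableOn F (polarRect r₀ R) :=
  hF.integrableOn (measurableSet_polarRect r₀ R) (isCompact_polarRect r₀ R).measure_lt_top

theorem BoundedMeasurableOn.comp_fst {r₀ R : ℝ} {u : ℝ → ℝ}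
    (hu : BoundedMeasurableOn u (Icc r₀ R)) :
    BoundedMeasurableOn (fun x : ℝ × ℝ => u x.1) (polarRect r₀ R) := by
  obtain ⟨hm, B, hB⟩ := hu
  refine ⟨?_, B, fun x hx => hB _ hx.1⟩
  have : (volume : Measure (ℝ × ℝ)).restrict (polarRect r₀ R) =
      (volume.restrict (Icc r₀ R)).prod (volume.restrict (Icc (-Real.pi) Real.pi)) := by
    rw [Measure.prod_restrict]; rfl
  rw [this]
  exact hm.comp_fst

theorem integral_polarRect {r₀ R : ℝ} (hR : r₀ ≤ R) {F : ℝ × ℝ → ℝ}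
    (hF : IntegrableOn F (polarRect r₀ R)) :
    ∫ x in polarRect r₀ R, F x = ∫ r in r₀..R, ∫ θ in (-Real.pi)..Real.pi, F (r, θ) := by
  have hF' : IntegrableOn F (Icc r₀ R ×ˢ Icc (-Real.pi) Real.pi) (volume.prod volume) := hF
  have := setIntegral_prod F hF'
  rw [intervalIntegral.integral_of_le hR, ← integral_Icc_eq_integral_Ioc]
  refine this.trans (integral_congr_ae (Filter.Eventually.of_forall fun r => ?_))
  simp only
  rw [intervalIntegral.integral_of_le (by linarith [Real.pi_pos]), ← integral_Icc_eq_integral_Ioc]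

theorem integral_polarRect_symm {r₀ R : ℝ} (hR : r₀ ≤ R) {F : ℝ × ℝ → ℝ}
    (hF : IntegrableOn F (polarRect r₀ R)) :
    ∫ x in polarRect r₀ R, F x = ∫ θ in (-Real.pi)..Real.pi, ∫ r in r₀..R, F (r, θ) := by
  have hF' : IntegrableOn F (Icc r₀ R ×ˢ Icc (-Real.pi) Real.pi) (volume.prod volume) := hF
  have hF2 : Integrable F
      ((volume.restrict (Icc r₀ R)).prod (volume.restrict (Icc (-Real.pi) Real.pi))) := by
    rw [Measure.prod_restrict]; exact hF'
  rw [intervalIntegral.integral_of_le (by linarith [Real.pi_pos]), ← integral_Icc_eq_integral_Ioc]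
  have h1 : ∫ x in polarRect r₀ R, F x = ∫ x, F x
      ∂((volume.restrict (Icc r₀ R)).prod (volume.restrict (Icc (-Real.pi) Real.pi))) := by
    rw [Measure.prod_restrict]; rfl
  rw [h1, integral_prod_symm F hF2]
  refine integral_congr_ae (Filter.Eventually.of_forall fun θ => ?_)
  simp only
  rw [intervalIntegral.integral_of_le hR, ← integral_Icc_eq_integral_Ioc]

/-- Integral over the rectangle of an `r`-derivative of a function vanishing at both ends. -/
theorem integral_polarRect_radial_deriv {r₀ R a : ℝ} (hR : r₀ ≤ R) {G D : ℝ → ℝ → ℝ}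
    (hD : BoundedMeasurableOn (fun x : ℝ × ℝ => D x.1 x.2) (polarRect r₀ R))
    (hDθ : ∀ θ, BoundedMeasurableOn (fun r => D r θ) (Icc r₀ R))
    (hG : ∀ θ, ContinuousOn (fun r => G r θ) (Icc r₀ R))
    (hGD : ∀ θ, ∀ r ∈ Ioo r₀ R, r ≠ a → HasDerivAt (fun r => G r θ) (D r θ) r)
    (h0 : ∀ θ, G r₀ θ = 0) (h1 : ∀ θ, G R θ = 0) :
    ∫ x in polarRect r₀ R, D x.1 x.2 = 0 := by
  rw [integral_polarRect_symm hR hD.polarRect_integrable]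
  have : ∀ θ, ∫ r in r₀..R, D r θ = 0 := by
    intro θ
    rw [MeasureTheory.integral_eq_of_hasDerivAt_off_countable_of_le (fun r => G r θ)
      (fun r => D r θ) hR (countable_singleton a) (hG θ)
      (fun r hr => hGD θ r hr.1 (fun h => hr.2 h)), h0, h1, sub_zero]
    rw [intervalIntegrable_iff_integrableOn_Icc_of_le hR]
    exact (hDθ θ).integrableOn measurableSet_Icc isCompact_Icc.measure_lt_top
  simp only [this, intervalIntegral.integral_zero]

/-- Integral over the rectangle of a radial multiple of an angular derivative of a
periodic function. -/
theorem integral_polarRect_angular_deriv {r₀ R : ℝ} (hR : r₀ ≤ R) {c : ℝ → ℝ} {G D : ℝ → ℝ → ℝ}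
    (hD : BoundedMeasurableOn (fun x : ℝ × ℝ => c x.1 * D x.1 x.2) (polarRect r₀ R))
    (hDr : ∀ r, Continuous (fun θ => D r θ))
    (hGD : ∀ r θ, HasDerivAt (fun θ => G r θ) (D r θ) θ)
    (hper : ∀ r, G r (-Real.pi) = G r Real.pi) :
    ∫ x in polarRect r₀ R, c x.1 * D x.1 x.2 = 0 := by
  rw [integral_polarRect hR hD.polarRect_integrable]
  have : ∀ r, ∫ θ in (-Real.pi)..Real.pi, c r * D r θ = 0 := by
    intro r
    rw [intervalIntegral.integral_const_mul,
      intervalIntegral.integral_eq_sub_of_hasDerivAt (fun θ _ => hGD r θ)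
        ((hDr r).intervalIntegrable _ _), hper, sub_self, mul_zero]
  simp only [this, intervalIntegral.integral_zero]

/-- A function in polar coordinates together with its partial derivatives up to second order,
periodic in the angle and vanishing to first order at `r = r₀` and `r = R`. -/
structure PolarJet (r₀ R : ℝ) where
  /-- the function -/
  g : ℝ → ℝ → ℝ
  /-- the radial derivative -/
  gr : ℝ → ℝ → ℝ
  /-- the angular derivative -/
  gt : ℝ → ℝ → ℝ
  /-- the second radial derivative -/
  grr : ℝ → ℝ → ℝ
  /-- the mixed derivative -/
  grt : ℝ → ℝ → ℝ
  /-- the second angular derivative -/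
  gtt : ℝ → ℝ → ℝ
  continuous_g : Continuous fun x : ℝ × ℝ => g x.1 x.2
  continuous_gr : Continuous fun x : ℝ × ℝ => gr x.1 x.2
  continuous_gt : Continuous fun x : ℝ × ℝ => gt x.1 x.2
  continuous_grr : Continuous fun x : ℝ × ℝ => grr x.1 x.2
  continuous_grt : Continuous fun x : ℝ × ℝ => grt x.1 x.2
  continuous_gtt : Continuous fun x : ℝ × ℝ => gtt x.1 x.2
  radial_g : ∀ r θ, HasDerivAt (fun r => g r θ) (gr r θ) r
  radial_gr : ∀ r θ, HasDerivAt (fun r => gr r θ) (grr r θ) r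
  radial_gt : ∀ r θ, HasDerivAt (fun r => gt r θ) (grt r θ) r
  angular_g : ∀ r θ, HasDerivAt (fun θ => g r θ) (gt r θ) θ
  angular_gr : ∀ r θ, HasDerivAt (fun θ => gr r θ) (grt r θ) θ
  angular_gt : ∀ r θ, HasDerivAt (fun θ => gt r θ) (gtt r θ) θ
  periodic_g : ∀ r, g r (-Real.pi) = g r Real.pi
  periodic_gr : ∀ r, gr r (-Real.pi) = gr r Real.pi
  periodic_gt : ∀ r, gt r (-Real.pi) = gt r Real.pi
  g_left : ∀ θ, g r₀ θ = 0
  gr_left : ∀ θ, gr r₀ θ = 0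
  gt_left : ∀ θ, gt r₀ θ = 0
  g_right : ∀ θ, g R θ = 0
  gr_right : ∀ θ, gr R θ = 0
  gt_right : ∀ θ, gt R θ = 0

/-- Radial weights for the energy method, together with their derivatives, smooth away from
`r = a`. -/
structure EnergyWeights (r₀ R a h : ℝ) where
  /-- the multiplier -/
  m : ℝ → ℝ
  /-- the derivative of the multiplier -/
  m' : ℝ → ℝ
  /-- the derivative of the phase -/
  q : ℝ → ℝ
  /-- the second derivative of the phase -/
  q' : ℝ → ℝ
  /-- the exponential weight times `r` -/
  W : ℝ → ℝ
  continuousOn_m : ContinuousOn m (Icc r₀ R)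
  continuousOn_q : ContinuousOn q (Icc r₀ R)
  continuousOn_W : ContinuousOn W (Icc r₀ R)
  bounded_m' : BoundedMeasurableOn m' (Icc r₀ R)
  bounded_q' : BoundedMeasurableOn q' (Icc r₀ R)
  hasDerivAt_m : ∀ r ∈ Ioo r₀ R, r ≠ a → HasDerivAt m (m' r) r
  hasDerivAt_q : ∀ r ∈ Ioo r₀ R, r ≠ a → HasDerivAt q (q' r) r
  hasDerivAt_W : ∀ r ∈ Ioo r₀ R, HasDerivAt W ((2 * q r / h + 1 / r) * W r) r
  m_nonneg : ∀ r ∈ Icc r₀ R, 0 ≤ m r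
  W_nonneg : ∀ r ∈ Icc r₀ R, 0 ≤ W r

section Energy

variable {r₀ R a h E : ℝ}

/-- The conjugated radial derivative. -/
noncomputable def PolarJet.conj (u : PolarJet r₀ R) (w : EnergyWeights r₀ R a h) (r θ : ℝ) : ℝ :=
  u.gr r θ + (w.q r / h + 1 / (2 * r)) * u.g r θ

/-- The semiclassical Schrödinger operator in polar coordinates. -/
noncomputable def PolarJet.op (u : PolarJet r₀ R) (h E : ℝ) (v : ℝ → ℝ → ℝ) (r θ : ℝ) : ℝ :=
  -h ^ 2 * (u.grr r θ + u.gr r θ / r + u.gtt r θ / r ^ 2) + (v r θ - E) * u.g r θ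

variable (u : PolarJet r₀ R) (w : EnergyWeights r₀ R a h)

/-- The radial derivative of `PolarJet.conj`. -/
noncomputable def PolarJet.conjRadial (r θ : ℝ) : ℝ :=
  u.grr r θ + (w.q' r / h - 1 / (2 * r ^ 2)) * u.g r θ + (w.q r / h + 1 / (2 * r)) * u.gr r θ

/-- The angular derivative of `PolarJet.conj`. -/
noncomputable def PolarJet.conjAngular (r θ : ℝ) : ℝ :=
  u.grt r θ + (w.q r / h + 1 / (2 * r)) * u.gt r θ

theorem PolarJet.hasDerivAt_conj_radial {r : ℝ} (hr₀ : 0 < r₀) (hr : r ∈ Ioo r₀ R) (ha : r ≠ a)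
    (θ : ℝ) : HasDerivAt (fun r => u.conj w r θ) (u.conjRadial w r θ) r := by
  have hr0 : r ≠ 0 := (hr₀.trans hr.1).ne'
  have h1 : HasDerivAt (fun r : ℝ => 1 / (2 * r)) (-(1 / (2 * r ^ 2))) r := by
    refine ((hasDerivAt_const r (1 : ℝ)).div ((hasDerivAt_id r).const_mul 2)
      (by simpa using hr0)).congr_deriv ?_
    simp only [id]
    field_simp
    norm_num
  refine ((u.radial_gr r θ).add ((((w.hasDerivAt_q r hr ha).div_const h).add h1).mul
    (u.radial_g r θ))).congr_deriv ?_
  simp only [PolarJet.conjRadial, Pi.add_apply]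
  ring

theorem PolarJet.hasDerivAt_conj_angular (r θ : ℝ) :
    HasDerivAt (fun θ => u.conj w r θ) (u.conjAngular w r θ) θ :=
  (u.angular_gr r θ).add ((u.angular_g r θ).const_mul _)

/-- The energy density. -/
noncomputable def PolarJet.energy (E r θ : ℝ) : ℝ :=
  w.m r * w.W r * (h ^ 2 * u.conj w r θ ^ 2 - h ^ 2 * (u.gt r θ ^ 2 / r ^ 2)
    + (h ^ 2 / (4 * r ^ 2) + E + w.q r ^ 2) * u.g r θ ^ 2)

/-- The radial derivative of `PolarJet.energy`. -/
noncomputable def PolarJet.energyRadial (E r θ : ℝ) : ℝ :=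
  w.W r * (w.m' r + w.m r * (2 * w.q r / h + 1 / r)) *
    (h ^ 2 * u.conj w r θ ^ 2 - h ^ 2 * (u.gt r θ ^ 2 / r ^ 2)
      + (h ^ 2 / (4 * r ^ 2) + E + w.q r ^ 2) * u.g r θ ^ 2)
  + w.m r * w.W r * (2 * h ^ 2 * u.conj w r θ * u.conjRadial w r θ
      - h ^ 2 * (2 * u.gt r θ * u.grt r θ / r ^ 2 - 2 * u.gt r θ ^ 2 / r ^ 3)
      + (-(h ^ 2 / (2 * r ^ 3)) + 2 * w.q r * w.q' r) * u.g r θ ^ 2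
      + (h ^ 2 / (4 * r ^ 2) + E + w.q r ^ 2) * (2 * u.g r θ * u.gr r θ))

theorem PolarJet.hasDerivAt_energy {r : ℝ} (hr₀ : 0 < r₀) (hr : r ∈ Ioo r₀ R) (ha : r ≠ a)
    (θ : ℝ) : HasDerivAt (fun r => u.energy w E r θ) (u.energyRadial w E r θ) r := by
  have hr0 : r ≠ 0 := (hr₀.trans hr.1).ne'
  have h1 : HasDerivAt (fun r : ℝ => h ^ 2 / (4 * r ^ 2)) (-(h ^ 2 / (2 * r ^ 3))) r := by
    refine ((hasDerivAt_const r (h ^ 2)).div (((hasDerivAt_id r).pow 2).const_mul 4)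
      (by simpa using hr0)).congr_deriv ?_
    simp only [id, Pi.pow_apply]
    field_simp
    norm_num
    ring
  have h2 := ((u.radial_gt r θ).pow 2).div ((hasDerivAt_id r).pow 2) (by simpa using hr0)
  have h3 := ((h1.add_const E).add ((w.hasDerivAt_q r hr ha).pow 2)).mul ((u.radial_g r θ).pow 2)
  have h4 := ((((u.hasDerivAt_conj_radial w hr₀ hr ha θ).pow 2).const_mul (h ^ 2)).sub
    (h2.const_mul (h ^ 2))).add h3
  have h5 := ((w.hasDerivAt_m r hr ha).mul (w.hasDerivAt_W r hr)).mul h4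
  refine h5.congr_deriv ?_
  simp [PolarJet.energyRadial]
  field_simp
  ring

/-- The radial derivative of `W g ^ 2`, up to the weight `m`. -/
noncomputable def PolarJet.densityRadial (r θ : ℝ) : ℝ :=
  w.W r * (w.m' r * u.g r θ ^ 2 + 2 * w.m r * u.g r θ * u.conj w r θ)

theorem PolarJet.hasDerivAt_density {r : ℝ} (hr₀ : 0 < r₀) (hr : r ∈ Ioo r₀ R) (ha : r ≠ a)
    (θ : ℝ) : HasDerivAt (fun r => w.m r * w.W r * u.g r θ ^ 2) (u.densityRadial w r θ) r := by
  have hr0 : r ≠ 0 := (hr₀.trans hr.1).ne'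
  have h5 := ((w.hasDerivAt_m r hr ha).mul (w.hasDerivAt_W r hr)).mul ((u.radial_g r θ).pow 2)
  refine h5.congr_deriv ?_
  simp [PolarJet.densityRadial, PolarJet.conj]
  field_simp
  ring

/-- The flux for the a priori bound on the radial derivative. -/
noncomputable def PolarJet.flux (r θ : ℝ) : ℝ :=
  w.W r * (h ^ 2 * u.g r θ * u.conj w r θ - h * w.q r * u.g r θ ^ 2)

/-- The radial derivative of `PolarJet.flux`. -/
noncomputable def PolarJet.fluxRadial (r θ : ℝ) : ℝ :=
  (2 * w.q r / h + 1 / r) * w.W r * (h ^ 2 * u.g r θ * u.conj w r θ - h * w.q r * u.g r θ ^ 2)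
  + w.W r * (h ^ 2 * (u.gr r θ * u.conj w r θ + u.g r θ * u.conjRadial w r θ)
    - h * (w.q' r * u.g r θ ^ 2 + w.q r * (2 * u.g r θ * u.gr r θ)))

theorem PolarJet.hasDerivAt_flux {r : ℝ} (hr₀ : 0 < r₀) (hr : r ∈ Ioo r₀ R) (ha : r ≠ a)
    (θ : ℝ) : HasDerivAt (fun r => u.flux w r θ) (u.fluxRadial w r θ) r := by
  have hr0 : r ≠ 0 := (hr₀.trans hr.1).ne'
  have h5 := (w.hasDerivAt_W r hr).mul ((((u.radial_g r θ).const_mul (h ^ 2)).mul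
    (u.hasDerivAt_conj_radial w hr₀ hr ha θ)).sub
      (((w.hasDerivAt_q r hr ha).const_mul h).mul ((u.radial_g r θ).pow 2)))
  refine h5.congr_deriv ?_
  simp only [PolarJet.fluxRadial, Pi.sub_apply, Pi.mul_apply, Pi.pow_apply]
  norm_num
  ring_nf
  simp

theorem PolarJet.energyRadial_identity {r : ℝ} (hh : 0 < h) (hr : 0 < r) (θ : ℝ)
    (v : ℝ → ℝ → ℝ) (B : ℝ → ℝ) :
    u.energyRadial w E r θ
      + 2 * (h ^ 2 * w.m r * w.W r / r ^ 2 *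
        (u.gtt r θ * u.conj w r θ + u.gt r θ * u.conjAngular w r θ))
      - (u.densityRadial w r θ * v r θ + B r * (w.m r * w.W r * u.g r θ ^ 2))
      + 2 * w.m r * w.W r * u.op h E v r θ * u.conj w r θ =
    w.W r * (((w.m' r + 4 * w.q r * w.m r / h) * (h * u.conj w r θ) ^ 2
      + (w.m' r * (E + w.q r ^ 2) + 2 * w.m r * w.q r * w.q' r
        - h ^ 2 / (4 * r ^ 2) * (2 * w.m r / r - w.m' r) - w.m' r * v r θ - B r * w.m r)
          * u.g r θ ^ 2
      + 2 * w.m r * w.q' r * u.g r θ * (h * u.conj w r θ))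
      + (2 * w.m r / r - w.m' r) * (h ^ 2 / r ^ 2) * u.gt r θ ^ 2) := by
  simp only [PolarJet.energyRadial, PolarJet.densityRadial, PolarJet.op, PolarJet.conjRadial,
    PolarJet.conjAngular, PolarJet.conj]
  field_simp
  ring

theorem PolarJet.fluxRadial_identity {r : ℝ} (hh : 0 < h) (hr : 0 < r) (θ : ℝ)
    (v : ℝ → ℝ → ℝ) :
    u.fluxRadial w r θ + h ^ 2 * w.W r / r ^ 2 * (u.gt r θ * u.gt r θ + u.g r θ * u.gtt r θ) =
      w.W r * (h ^ 2 * u.conj w r θ ^ 2) + h ^ 2 * w.W r / r ^ 2 * u.gt r θ ^ 2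
      - w.W r * (u.op h E v r θ * u.g r θ
        + (E + w.q r ^ 2 - v r θ + h ^ 2 / (4 * r ^ 2)) * u.g r θ ^ 2) := by
  simp only [PolarJet.fluxRadial, PolarJet.op, PolarJet.conjRadial, PolarJet.conj]
  field_simp
  ring

end Energy

section Regularity

variable {r₀ R a h E : ℝ} {α : Type*} [MeasureSpace α] {S : Set α} {ρ ϑ : α → ℝ}

/-- A pair of coordinate functions under which radial and jointly continuous functions pull back
to bounded measurable ones. -/
structure IsPolarChart (r₀ R : ℝ) (S : Set α) (ρ ϑ : α → ℝ) : Prop where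
  radial : ∀ F : ℝ → ℝ, BoundedMeasurableOn F (Icc r₀ R) → BoundedMeasurableOn (fun x => F (ρ x)) S
  joint : ∀ F : ℝ × ℝ → ℝ, Continuous F → BoundedMeasurableOn (fun x => F (ρ x, ϑ x)) S

theorem isPolarChart_rect (r₀ R : ℝ) : IsPolarChart r₀ R (polarRect r₀ R) Prod.fst Prod.snd where
  radial _ hF := hF.comp_fst
  joint _ hF := .of_continuousOn (isCompact_polarRect r₀ R) (measurableSet_polarRect r₀ R)
    hF.continuousOn

theorem isPolarChart_section (r₀ R θ : ℝ) :
    IsPolarChart r₀ R (Icc r₀ R) id (fun _ => θ) where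
  radial _ hF := hF
  joint _ hF := .of_continuousOn isCompact_Icc measurableSet_Icc
    (hF.comp (by fun_prop : Continuous fun r : ℝ => (r, θ))).continuousOn

namespace IsPolarChart

theorem continuousOn (hc : IsPolarChart r₀ R S ρ ϑ) {F : ℝ → ℝ} (hF : ContinuousOn F (Icc r₀ R)) :
    BoundedMeasurableOn (fun x => F (ρ x)) S :=
  hc.radial F (.of_continuousOn isCompact_Icc measurableSet_Icc hF)

theorem inv (hc : IsPolarChart r₀ R S ρ ϑ) (hr₀ : 0 < r₀) : BoundedMeasurableOn (fun x => (ρ x)⁻¹) S :=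
  hc.continuousOn (continuousOn_id.inv₀ fun _ hx => (hr₀.trans_le hx.1).ne')

end IsPolarChart

variable (u : PolarJet r₀ R) (w : EnergyWeights r₀ R a h)

theorem PolarJet.bounded_conj (hc : IsPolarChart r₀ R S ρ ϑ) (hr₀ : 0 < r₀) :
    BoundedMeasurableOn (fun x => u.conj w (ρ x) (ϑ x)) S := by
  have hi := hc.inv hr₀
  have hq := hc.continuousOn w.continuousOn_q
  have h1 := hc.joint _ u.continuous_g
  have h2 := hc.joint _ u.continuous_gr
  simp only [PolarJet.conj, div_eq_mul_inv, mul_inv]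
  repeat' first
    | assumption
    | exact BoundedMeasurableOn.const _
    | apply BoundedMeasurableOn.add
    | apply BoundedMeasurableOn.mul

theorem PolarJet.bounded_conjRadial (hc : IsPolarChart r₀ R S ρ ϑ) (hr₀ : 0 < r₀) :
    BoundedMeasurableOn (fun x => u.conjRadial w (ρ x) (ϑ x)) S := by
  have hi := hc.inv hr₀
  have hq := hc.continuousOn w.continuousOn_q
  have hq' := hc.radial _ w.bounded_q'
  have h1 := hc.joint _ u.continuous_g
  have h2 := hc.joint _ u.continuous_gr
  have h3 := hc.joint _ u.continuous_grr
  simp only [PolarJet.conjRadial, div_eq_mul_inv, mul_inv, ← inv_pow]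
  repeat' first
    | assumption
    | exact BoundedMeasurableOn.const _
    | apply BoundedMeasurableOn.add
    | apply BoundedMeasurableOn.neg
    | apply BoundedMeasurableOn.mul

theorem PolarJet.bounded_conjAngular (hc : IsPolarChart r₀ R S ρ ϑ) (hr₀ : 0 < r₀) :
    BoundedMeasurableOn (fun x => u.conjAngular w (ρ x) (ϑ x)) S := by
  have hi := hc.inv hr₀
  have hq := hc.continuousOn w.continuousOn_q
  have h1 := hc.joint _ u.continuous_grt
  have h2 := hc.joint _ u.continuous_gt
  simp only [PolarJet.conjAngular, div_eq_mul_inv, mul_inv]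
  repeat' first
    | assumption
    | exact BoundedMeasurableOn.const _
    | apply BoundedMeasurableOn.add
    | apply BoundedMeasurableOn.mul

theorem PolarJet.bounded_op (hc : IsPolarChart r₀ R S ρ ϑ) (hr₀ : 0 < r₀) {v : ℝ → ℝ → ℝ}
    (hv : BoundedMeasurableOn (fun x => v (ρ x) (ϑ x)) S) :
    BoundedMeasurableOn (fun x => u.op h E v (ρ x) (ϑ x)) S := by
  have hi := hc.inv hr₀
  have h1 := hc.joint _ u.continuous_grr
  have h2 := hc.joint _ u.continuous_gr
  have h3 := hc.joint _ u.continuous_gtt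
  have h4 := hc.joint _ u.continuous_g
  simp only [PolarJet.op, div_eq_mul_inv, ← inv_pow]
  repeat' first
    | assumption
    | exact BoundedMeasurableOn.const _
    | apply BoundedMeasurableOn.add
    | apply BoundedMeasurableOn.neg
    | apply BoundedMeasurableOn.mul

theorem PolarJet.bounded_energyRadial (hc : IsPolarChart r₀ R S ρ ϑ) (hr₀ : 0 < r₀) :
    BoundedMeasurableOn (fun x => u.energyRadial w E (ρ x) (ϑ x)) S := by
  have hi := hc.inv hr₀
  have hm := hc.continuousOn w.continuousOn_m
  have hq := hc.continuousOn w.continuousOn_q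
  have hW := hc.continuousOn w.continuousOn_W
  have hm' := hc.radial _ w.bounded_m'
  have hq' := hc.radial _ w.bounded_q'
  have h1 := hc.joint _ u.continuous_g
  have h2 := hc.joint _ u.continuous_gr
  have h3 := hc.joint _ u.continuous_gt
  have h4 := hc.joint _ u.continuous_grt
  have h5 := u.bounded_conj w hc hr₀
  have h6 := u.bounded_conjRadial w hc hr₀
  simp only [PolarJet.energyRadial, div_eq_mul_inv, mul_inv, ← inv_pow]
  repeat' first
    | assumption
    | exact BoundedMeasurableOn.const _
    | apply BoundedMeasurableOn.add
    | apply BoundedMeasurableOn.neg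
    | apply BoundedMeasurableOn.mul

theorem PolarJet.bounded_densityRadial (hc : IsPolarChart r₀ R S ρ ϑ) (hr₀ : 0 < r₀) :
    BoundedMeasurableOn (fun x => u.densityRadial w (ρ x) (ϑ x)) S := by
  have hm := hc.continuousOn w.continuousOn_m
  have hW := hc.continuousOn w.continuousOn_W
  have hm' := hc.radial _ w.bounded_m'
  have h1 := hc.joint _ u.continuous_g
  have h5 := u.bounded_conj w hc hr₀
  simp only [PolarJet.densityRadial]
  repeat' first
    | assumption
    | exact BoundedMeasurableOn.const _
    | apply BoundedMeasurableOn.add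
    | apply BoundedMeasurableOn.mul

theorem PolarJet.bounded_fluxRadial (hc : IsPolarChart r₀ R S ρ ϑ) (hr₀ : 0 < r₀) :
    BoundedMeasurableOn (fun x => u.fluxRadial w (ρ x) (ϑ x)) S := by
  have hi := hc.inv hr₀
  have hq := hc.continuousOn w.continuousOn_q
  have hW := hc.continuousOn w.continuousOn_W
  have hq' := hc.radial _ w.bounded_q'
  have h1 := hc.joint _ u.continuous_g
  have h2 := hc.joint _ u.continuous_gr
  have h5 := u.bounded_conj w hc hr₀
  have h6 := u.bounded_conjRadial w hc hr₀
  simp only [PolarJet.fluxRadial, div_eq_mul_inv]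
  repeat' first
    | assumption
    | exact BoundedMeasurableOn.const _
    | apply BoundedMeasurableOn.add
    | apply BoundedMeasurableOn.neg
    | apply BoundedMeasurableOn.mul

end Regularity

section EnergyEstimates

variable {r₀ R a h E : ℝ} (u : PolarJet r₀ R) (w : EnergyWeights r₀ R a h) {v : ℝ → ℝ → ℝ}

theorem PolarJet.integral_energyRadial (hr₀ : 0 < r₀) (hR : r₀ ≤ R) :
    ∫ x in polarRect r₀ R, u.energyRadial w E x.1 x.2 = 0 := by
  refine integral_polarRect_radial_deriv (a := a) (G := u.energy w E) hR
    (u.bounded_energyRadial w (isPolarChart_rect r₀ R) hr₀)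
    (fun θ => u.bounded_energyRadial w (isPolarChart_section r₀ R θ) hr₀) (fun θ => ?_)
    (fun θ r hr ha => u.hasDerivAt_energy w hr₀ hr ha θ)
    (fun θ => by simp [PolarJet.energy, PolarJet.conj, u.g_left, u.gr_left, u.gt_left])
    (fun θ => by simp [PolarJet.energy, PolarJet.conj, u.g_right, u.gr_right, u.gt_right])
  have hc : ∀ F : ℝ × ℝ → ℝ, Continuous F → ContinuousOn (fun r => F (r, θ)) (Icc r₀ R) :=
    fun F hF => (hF.comp (by fun_prop : Continuous fun r : ℝ => (r, θ))).continuousOn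
  have h1 := hc _ u.continuous_g
  have h2 := hc _ u.continuous_gr
  have h3 := hc _ u.continuous_gt
  have hm := w.continuousOn_m
  have hq := w.continuousOn_q
  have hW := w.continuousOn_W
  have hpos : ∀ r ∈ Icc r₀ R, r ≠ 0 := fun r hr => (hr₀.trans_le hr.1).ne'
  simp only [PolarJet.energy, PolarJet.conj]
  fun_prop (disch := first | assumption | (intro r hr; have := hpos r hr; positivity))

theorem PolarJet.integral_fluxRadial (hr₀ : 0 < r₀) (hR : r₀ ≤ R) :
    ∫ x in polarRect r₀ R, u.fluxRadial w x.1 x.2 = 0 := by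
  refine integral_polarRect_radial_deriv (a := a) (G := u.flux w) hR
    (u.bounded_fluxRadial w (isPolarChart_rect r₀ R) hr₀)
    (fun θ => u.bounded_fluxRadial w (isPolarChart_section r₀ R θ) hr₀) (fun θ => ?_)
    (fun θ r hr ha => u.hasDerivAt_flux w hr₀ hr ha θ)
    (fun θ => by simp [PolarJet.flux, u.g_left])
    (fun θ => by simp [PolarJet.flux, u.g_right])
  have hc : ∀ F : ℝ × ℝ → ℝ, Continuous F → ContinuousOn (fun r => F (r, θ)) (Icc r₀ R) :=
    fun F hF => (hF.comp (by fun_prop : Continuous fun r : ℝ => (r, θ))).continuousOn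
  have h1 := hc _ u.continuous_g
  have h2 := hc _ u.continuous_gr
  have hq := w.continuousOn_q
  have hW := w.continuousOn_W
  have hpos : ∀ r ∈ Icc r₀ R, r ≠ 0 := fun r hr => (hr₀.trans_le hr.1).ne'
  simp only [PolarJet.flux, PolarJet.conj]
  fun_prop (disch := first | assumption | (intro r hr; have := hpos r hr; positivity))

theorem PolarJet.integral_density_nonneg (hr₀ : 0 < r₀) (hR : r₀ ≤ R)
    (hv : BoundedMeasurableOn (fun x : ℝ × ℝ => v x.1 x.2) (polarRect r₀ R))
    (hvac : ∀ θ, AbsolutelyContinuousOnInterval (fun r => v r θ) r₀ R)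
    {B : ℝ → ℝ} (hB : ContinuousOn B (Icc r₀ R))
    (hvB : ∀ θ, ∀ᵐ r, r ∈ Icc r₀ R → deriv (fun r => v r θ) r ≤ B r) :
    0 ≤ ∫ x in polarRect r₀ R, (u.densityRadial w x.1 x.2 * v x.1 x.2
      + B x.1 * (w.m x.1 * w.W x.1 * u.g x.1 x.2 ^ 2)) := by
  have hc := isPolarChart_rect r₀ R
  have hb : BoundedMeasurableOn (fun x : ℝ × ℝ => u.densityRadial w x.1 x.2 * v x.1 x.2
      + B x.1 * (w.m x.1 * w.W x.1 * u.g x.1 x.2 ^ 2)) (polarRect r₀ R) :=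
    ((u.bounded_densityRadial w hc hr₀).mul hv).add ((hc.continuousOn hB).mul
      (((hc.continuousOn w.continuousOn_m).mul (hc.continuousOn w.continuousOn_W)).mul
        ((hc.joint _ u.continuous_g).pow 2)))
  rw [integral_polarRect_symm hR hb.polarRect_integrable]
  refine intervalIntegral.integral_nonneg (by linarith [Real.pi_pos]) fun θ _ => ?_
  have hg : ContinuousOn (fun r => u.g r θ) (Icc r₀ R) :=
    (u.continuous_g.comp (by fun_prop : Continuous fun r : ℝ => (r, θ))).continuousOn
  refine integral_deriv_mul_add_nonneg (ψ := fun r => w.m r * w.W r * u.g r θ ^ 2) (a := a) hR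
    ((w.continuousOn_m.mul w.continuousOn_W).mul (hg.pow 2))
    (fun r hr ha => u.hasDerivAt_density w hr₀ hr ha θ) ?_ (by simp [u.g_left])
    (by simp [u.g_right])
    (fun r hr => mul_nonneg (mul_nonneg (w.m_nonneg r hr) (w.W_nonneg r hr)) (sq_nonneg _))
    (hvac θ) hB (hvB θ)
  rw [intervalIntegrable_iff_integrableOn_Icc_of_le hR]
  exact (u.bounded_densityRadial w (isPolarChart_section r₀ R θ) hr₀).integrableOn
    measurableSet_Icc isCompact_Icc.measure_lt_top

/-- The weighted energy inequality. -/
theorem PolarJet.energy_estimate (hh : 0 < h) (hr₀ : 0 < r₀) (hR : r₀ ≤ R)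
    (hv : BoundedMeasurableOn (fun x : ℝ × ℝ => v x.1 x.2) (polarRect r₀ R))
    (hvac : ∀ θ, AbsolutelyContinuousOnInterval (fun r => v r θ) r₀ R)
    {B : ℝ → ℝ} (hB : ContinuousOn B (Icc r₀ R))
    (hvB : ∀ θ, ∀ᵐ r, r ∈ Icc r₀ R → deriv (fun r => v r θ) r ≤ B r)
    (hcone : ∀ r ∈ Icc r₀ R, r * w.m' r ≤ 2 * w.m r)
    (hpos : ∀ r ∈ Icc r₀ R, ∀ θ X Y : ℝ,
      w.m' r / 2 * X ^ 2 + E / 8 * w.m' r * Y ^ 2 ≤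
        (w.m' r + 4 * w.q r * w.m r / h) * X ^ 2
      + (w.m' r * (E + w.q r ^ 2) + 2 * w.m r * w.q r * w.q' r
        - h ^ 2 / (4 * r ^ 2) * (2 * w.m r / r - w.m' r) - w.m' r * v r θ - B r * w.m r) * Y ^ 2
      + 2 * w.m r * w.q' r * Y * X) :
    ∫ x in polarRect r₀ R, w.W x.1 * (w.m' x.1 / 2 * (h * u.conj w x.1 x.2) ^ 2
        + E / 8 * w.m' x.1 * u.g x.1 x.2 ^ 2) ≤
      ∫ x in polarRect r₀ R, 2 * w.m x.1 * w.W x.1 * u.op h E v x.1 x.2 * u.conj w x.1 x.2 := by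
  have hc := isPolarChart_rect r₀ R
  have bm := hc.continuousOn w.continuousOn_m
  have bW := hc.continuousOn w.continuousOn_W
  have bm' := hc.radial _ w.bounded_m'
  have bg := hc.joint _ u.continuous_g
  have bgt := hc.joint _ u.continuous_gt
  have bgtt := hc.joint _ u.continuous_gtt
  have bp := u.bounded_conj w hc hr₀
  have bpt := u.bounded_conjAngular w hc hr₀
  have bo := u.bounded_op (h := h) (E := E) hc hr₀ hv
  have bi := hc.inv hr₀
  have be := u.bounded_energyRadial (E := E) w hc hr₀
  have bd : BoundedMeasurableOn (fun x : ℝ × ℝ => u.densityRadial w x.1 x.2 * v x.1 x.2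
      + B x.1 * (w.m x.1 * w.W x.1 * u.g x.1 x.2 ^ 2)) (polarRect r₀ R) :=
    ((u.bounded_densityRadial w hc hr₀).mul hv).add ((hc.continuousOn hB).mul
      (((hc.continuousOn w.continuousOn_m).mul (hc.continuousOn w.continuousOn_W)).mul
        ((hc.joint _ u.continuous_g).pow 2)))
  have bT : BoundedMeasurableOn (fun x : ℝ × ℝ => h ^ 2 * w.m x.1 * w.W x.1 / x.1 ^ 2 *
      (u.gtt x.1 x.2 * u.conj w x.1 x.2 + u.gt x.1 x.2 * u.conjAngular w x.1 x.2))
      (polarRect r₀ R) := by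
    simp only [div_eq_mul_inv, ← inv_pow]
    exact (((((BoundedMeasurableOn.const _).mul bm).mul bW).mul (bi.pow 2))).mul
      ((bgtt.mul bp).add (bgt.mul bpt))
  have bL : BoundedMeasurableOn (fun x : ℝ × ℝ => w.W x.1 *
      (w.m' x.1 / 2 * (h * u.conj w x.1 x.2) ^ 2 + E / 8 * w.m' x.1 * u.g x.1 x.2 ^ 2))
      (polarRect r₀ R) := by
    simp only [div_eq_mul_inv]
    exact bW.mul (((bm'.mul (.const _)).mul (((BoundedMeasurableOn.const _).mul bp).pow 2)).add
      (((BoundedMeasurableOn.const _).mul bm').mul (bg.pow 2)))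
  have bQ : BoundedMeasurableOn (fun x : ℝ × ℝ => 2 * w.m x.1 * w.W x.1 * u.op h E v x.1 x.2 *
      u.conj w x.1 x.2) (polarRect r₀ R) :=
    ((((BoundedMeasurableOn.const _).mul bm).mul bW).mul bo).mul bp
  have iT : ∫ x in polarRect r₀ R, h ^ 2 * w.m x.1 * w.W x.1 / x.1 ^ 2 *
      (u.gtt x.1 x.2 * u.conj w x.1 x.2 + u.gt x.1 x.2 * u.conjAngular w x.1 x.2) = 0 := by
    refine integral_polarRect_angular_deriv (c := fun r => h ^ 2 * w.m r * w.W r / r ^ 2)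
      (G := fun r θ => u.gt r θ * u.conj w r θ)
      (D := fun r θ => u.gtt r θ * u.conj w r θ + u.gt r θ * u.conjAngular w r θ)
      hR bT (fun r => ?_)
      (fun r θ => (u.angular_gt r θ).mul (u.hasDerivAt_conj_angular w r θ))
      (fun r => by simp [PolarJet.conj, u.periodic_g, u.periodic_gr, u.periodic_gt])
    have hcr : ∀ F : ℝ × ℝ → ℝ, Continuous F → Continuous (fun θ => F (r, θ)) :=
      fun F hF => hF.comp (by fun_prop)
    have h1 := hcr _ u.continuous_g
    have h2 := hcr _ u.continuous_gr
    have h3 := hcr _ u.continuous_gt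
    have h4 := hcr _ u.continuous_gtt
    have h5 := hcr _ u.continuous_grt
    simp only [PolarJet.conj, PolarJet.conjAngular]
    fun_prop
  have key : ∫ x in polarRect r₀ R, (w.W x.1 *
      (w.m' x.1 / 2 * (h * u.conj w x.1 x.2) ^ 2 + E / 8 * w.m' x.1 * u.g x.1 x.2 ^ 2)) ≤
      ∫ x in polarRect r₀ R, (u.energyRadial w E x.1 x.2
      + 2 * (h ^ 2 * w.m x.1 * w.W x.1 / x.1 ^ 2 *
        (u.gtt x.1 x.2 * u.conj w x.1 x.2 + u.gt x.1 x.2 * u.conjAngular w x.1 x.2))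
      - (u.densityRadial w x.1 x.2 * v x.1 x.2 + B x.1 * (w.m x.1 * w.W x.1 * u.g x.1 x.2 ^ 2))
      + 2 * w.m x.1 * w.W x.1 * u.op h E v x.1 x.2 * u.conj w x.1 x.2) := by
    refine setIntegral_mono_on bL.polarRect_integrable
      (((be.add ((BoundedMeasurableOn.const 2).mul bT)).sub bd).add bQ).polarRect_integrable
      (measurableSet_polarRect r₀ R) fun x hx => ?_
    have hr : 0 < x.1 := hr₀.trans_le hx.1.1
    rw [u.energyRadial_identity w hh hr]
    refine mul_le_mul_of_nonneg_left ?_ (w.W_nonneg _ hx.1)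
    have h1 := hpos x.1 hx.1 x.2 (h * u.conj w x.1 x.2) (u.g x.1 x.2)
    have h2 : 0 ≤ 2 * w.m x.1 / x.1 - w.m' x.1 := by
      rw [sub_nonneg, le_div_iff₀ hr, mul_comm]
      exact hcone x.1 hx.1
    have h3 : 0 ≤ (2 * w.m x.1 / x.1 - w.m' x.1) * (h ^ 2 / x.1 ^ 2) * u.gt x.1 x.2 ^ 2 := by
      positivity
    linarith
  refine key.trans ?_
  rw [integral_add, integral_sub, integral_add, integral_const_mul, iT,
    u.integral_energyRadial w hr₀ hR]
  · have := u.integral_density_nonneg w hr₀ hR hv hvac hB hvB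
    linarith
  · exact be.polarRect_integrable
  · exact ((BoundedMeasurableOn.const 2).mul bT).polarRect_integrable
  · exact (be.add ((BoundedMeasurableOn.const 2).mul bT)).polarRect_integrable
  · exact bd.polarRect_integrable
  · exact ((be.add ((BoundedMeasurableOn.const 2).mul bT)).sub bd).polarRect_integrable
  · exact bQ.polarRect_integrable

/-- The radial derivative is controlled by the operator and the function itself. -/
theorem PolarJet.conj_estimate (hh : 0 < h) (hr₀ : 0 < r₀) (hR : r₀ ≤ R)
    (hv : BoundedMeasurableOn (fun x : ℝ × ℝ => v x.1 x.2) (polarRect r₀ R)) :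
    ∫ x in polarRect r₀ R, w.W x.1 * (h * u.conj w x.1 x.2) ^ 2 ≤
      ∫ x in polarRect r₀ R, w.W x.1 * (u.op h E v x.1 x.2 * u.g x.1 x.2
        + (E + w.q x.1 ^ 2 - v x.1 x.2 + h ^ 2 / (4 * x.1 ^ 2)) * u.g x.1 x.2 ^ 2) := by
  have hc := isPolarChart_rect r₀ R
  have bq := hc.continuousOn w.continuousOn_q
  have bW := hc.continuousOn w.continuousOn_W
  have bg := hc.joint _ u.continuous_g
  have bgt := hc.joint _ u.continuous_gt
  have bgtt := hc.joint _ u.continuous_gtt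
  have bp := u.bounded_conj w hc hr₀
  have bo := u.bounded_op (h := h) (E := E) hc hr₀ hv
  have bi := hc.inv hr₀
  have bf := u.bounded_fluxRadial w hc hr₀
  have bT : BoundedMeasurableOn (fun x : ℝ × ℝ => h ^ 2 * w.W x.1 / x.1 ^ 2 *
      (u.gt x.1 x.2 * u.gt x.1 x.2 + u.g x.1 x.2 * u.gtt x.1 x.2)) (polarRect r₀ R) := by
    simp only [div_eq_mul_inv, ← inv_pow]
    exact ((((BoundedMeasurableOn.const _).mul bW).mul (bi.pow 2))).mul
      ((bgt.mul bgt).add (bg.mul bgtt))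
  have bL : BoundedMeasurableOn (fun x : ℝ × ℝ => w.W x.1 * (h * u.conj w x.1 x.2) ^ 2)
      (polarRect r₀ R) := bW.mul (((BoundedMeasurableOn.const _).mul bp).pow 2)
  have bQ : BoundedMeasurableOn (fun x : ℝ × ℝ => w.W x.1 * (u.op h E v x.1 x.2 * u.g x.1 x.2
      + (E + w.q x.1 ^ 2 - v x.1 x.2 + h ^ 2 / (4 * x.1 ^ 2)) * u.g x.1 x.2 ^ 2))
      (polarRect r₀ R) := by
    simp only [div_eq_mul_inv, mul_inv, ← inv_pow]
    exact bW.mul ((bo.mul bg).add (((((BoundedMeasurableOn.const E).add (bq.pow 2)).sub hv).add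
      ((BoundedMeasurableOn.const (h ^ 2)).mul ((BoundedMeasurableOn.const _).mul
        (bi.pow 2)))).mul (bg.pow 2)))
  have iT : ∫ x in polarRect r₀ R, h ^ 2 * w.W x.1 / x.1 ^ 2 *
      (u.gt x.1 x.2 * u.gt x.1 x.2 + u.g x.1 x.2 * u.gtt x.1 x.2) = 0 := by
    refine integral_polarRect_angular_deriv (c := fun r => h ^ 2 * w.W r / r ^ 2)
      (G := fun r θ => u.g r θ * u.gt r θ)
      (D := fun r θ => u.gt r θ * u.gt r θ + u.g r θ * u.gtt r θ) hR bT (fun r => ?_)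
      (fun r θ => (u.angular_g r θ).mul (u.angular_gt r θ))
      (fun r => by simp [u.periodic_g, u.periodic_gt])
    have hcr : ∀ F : ℝ × ℝ → ℝ, Continuous F → Continuous (fun θ => F (r, θ)) :=
      fun F hF => hF.comp (by fun_prop)
    have h1 := hcr _ u.continuous_g
    have h3 := hcr _ u.continuous_gt
    have h4 := hcr _ u.continuous_gtt
    fun_prop
  have key : ∫ x in polarRect r₀ R, w.W x.1 * (h * u.conj w x.1 x.2) ^ 2 ≤
      ∫ x in polarRect r₀ R, (u.fluxRadial w x.1 x.2 + h ^ 2 * w.W x.1 / x.1 ^ 2 *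
        (u.gt x.1 x.2 * u.gt x.1 x.2 + u.g x.1 x.2 * u.gtt x.1 x.2)
      + w.W x.1 * (u.op h E v x.1 x.2 * u.g x.1 x.2
        + (E + w.q x.1 ^ 2 - v x.1 x.2 + h ^ 2 / (4 * x.1 ^ 2)) * u.g x.1 x.2 ^ 2)) := by
    refine setIntegral_mono_on bL.polarRect_integrable
      ((bf.add bT).add bQ).polarRect_integrable (measurableSet_polarRect r₀ R) fun x hx => ?_
    have hr : 0 < x.1 := hr₀.trans_le hx.1.1
    rw [u.fluxRadial_identity (E := E) w hh hr x.2 v]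
    have h3 : 0 ≤ h ^ 2 * w.W x.1 / x.1 ^ 2 * u.gt x.1 x.2 ^ 2 := by
      have := w.W_nonneg _ hx.1
      positivity
    linarith
  refine key.trans ?_
  rw [integral_add, integral_add, iT, u.integral_fluxRadial w hr₀ hR]
  · simp
  · exact bf.polarRect_integrable
  · exact bT.polarRect_integrable
  · exact (bf.add bT).polarRect_integrable
  · exact bQ.polarRect_integrable

end EnergyEstimates

/-- The radial unit vector at angle `θ`. -/
noncomputable def unitRadial (θ : ℝ) : EuclideanSpace ℝ (Fin 2) :=
  Real.cos θ • EuclideanSpace.single 0 1 + Real.sin θ • EuclideanSpace.single 1 1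

/-- The angular unit vector at angle `θ`. -/
noncomputable def unitAngular (θ : ℝ) : EuclideanSpace ℝ (Fin 2) :=
  -Real.sin θ • EuclideanSpace.single 0 1 + Real.cos θ • EuclideanSpace.single 1 1

theorem norm_unitRadial (θ : ℝ) : ‖unitRadial θ‖ = 1 := by
  simp [unitRadial, EuclideanSpace.norm_eq]

theorem norm_smul_unitRadial {r : ℝ} (hr : 0 ≤ r) (θ : ℝ) : ‖r • unitRadial θ‖ = r := by
  rw [norm_smul, norm_unitRadial, mul_one, Real.norm_of_nonneg hr]

theorem hasDerivAt_unitRadial (θ : ℝ) : HasDerivAt unitRadial (unitAngular θ) θ :=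
  ((Real.hasDerivAt_cos θ).smul_const _).add ((Real.hasDerivAt_sin θ).smul_const _)

theorem hasDerivAt_unitAngular (θ : ℝ) : HasDerivAt unitAngular (-unitRadial θ) θ := by
  refine (((Real.hasDerivAt_sin θ).neg.smul_const _).add
    ((Real.hasDerivAt_cos θ).smul_const _)).congr_deriv ?_
  rw [unitRadial]
  module

theorem continuous_unitRadial : Continuous unitRadial :=
  continuous_iff_continuousAt.2 fun θ => (hasDerivAt_unitRadial θ).continuousAt

theorem continuous_unitAngular : Continuous unitAngular :=
  continuous_iff_continuousAt.2 fun θ => (hasDerivAt_unitAngular θ).continuousAt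

theorem unitRadial_neg_pi : unitRadial (-Real.pi) = unitRadial Real.pi := by
  simp [unitRadial]

theorem unitAngular_neg_pi : unitAngular (-Real.pi) = unitAngular Real.pi := by
  simp [unitAngular]

section Jet

variable {f : EuclideanSpace ℝ (Fin 2) → ℂ}

theorem lap_eq_polar (hf : ContDiff ℝ 2 f) (x : EuclideanSpace ℝ (Fin 2)) (θ : ℝ) :
    lap f x = fderiv ℝ (fderiv ℝ f) x (unitRadial θ) (unitRadial θ)
      + fderiv ℝ (fderiv ℝ f) x (unitAngular θ) (unitAngular θ) := by
  have hd : DifferentiableAt ℝ (fderiv ℝ f) x :=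
    ((hf.fderiv_right (m := 1) (by norm_num)).differentiable (by norm_num)) x
  have h : ∀ e, fderiv ℝ (fun y => fderiv ℝ f y e) x e = fderiv ℝ (fderiv ℝ f) x e e := by
    intro e
    rw [fderiv_clm_apply hd (differentiableAt_const e)]
    simp
  simp only [lap, h, Fin.sum_univ_two, unitRadial, unitAngular, map_add, map_smul,
    add_apply, smul_apply]
  generalize fderiv ℝ (fderiv ℝ f) x (EuclideanSpace.single 0 1) (EuclideanSpace.single 0 1) = A
  generalize fderiv ℝ (fderiv ℝ f) x (EuclideanSpace.single 1 1) (EuclideanSpace.single 1 1) = B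
  simp only [smul_add, smul_smul]
  have hA : (Real.cos θ * Real.cos θ + -Real.sin θ * -Real.sin θ) • A = A := by
    rw [show Real.cos θ * Real.cos θ + -Real.sin θ * -Real.sin θ = 1 by
      nlinarith [Real.sin_sq_add_cos_sq θ], one_smul]
  have hB : (Real.sin θ * Real.sin θ + Real.cos θ * Real.cos θ) • B = B := by
    rw [show Real.sin θ * Real.sin θ + Real.cos θ * Real.cos θ = 1 by
      nlinarith [Real.sin_sq_add_cos_sq θ], one_smul]
  nth_rewrite 1 [← hA, ← hB]
  module

/-- The polar jet of a real component of a smooth function on the plane. -/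
noncomputable def polarJet (L : ℂ →L[ℝ] ℝ) (hf : ContDiff ℝ 2 f) {r₀ R : ℝ} (hr₀ : 0 ≤ r₀)
    (hR : 0 ≤ R) (h0 : ∀ x, ‖x‖ = r₀ → f x = 0 ∧ fderiv ℝ f x = 0)
    (h1 : ∀ x, ‖x‖ = R → f x = 0 ∧ fderiv ℝ f x = 0) : PolarJet r₀ R :=
  have hc : Continuous fun x : ℝ × ℝ => x.1 • unitRadial x.2 :=
    continuous_fst.smul (continuous_unitRadial.comp continuous_snd)
  have cr : Continuous fun x : ℝ × ℝ => unitRadial x.2 := continuous_unitRadial.comp continuous_snd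
  have ct : Continuous fun x : ℝ × ℝ => unitAngular x.2 :=
    continuous_unitAngular.comp continuous_snd
  have c0 : Continuous fun x : ℝ × ℝ => f (x.1 • unitRadial x.2) := hf.continuous.comp hc
  have hf1 : ContDiff ℝ 1 (fderiv ℝ f) := hf.fderiv_right (by norm_num)
  have c1 : Continuous fun x : ℝ × ℝ => fderiv ℝ f (x.1 • unitRadial x.2) := hf1.continuous.comp hc
  have c2 : Continuous fun x : ℝ × ℝ => fderiv ℝ (fderiv ℝ f) (x.1 • unitRadial x.2) :=
    (hf1.continuous_fderiv (by norm_num)).comp hc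
  have d0 : ∀ x, HasFDerivAt f (fderiv ℝ f x) x :=
    fun x => (hf.differentiable (by norm_num) x).hasFDerivAt
  have d1 : ∀ x, HasFDerivAt (fderiv ℝ f) (fderiv ℝ (fderiv ℝ f) x) x :=
    fun x => (hf1.differentiable (by norm_num) x).hasFDerivAt
  have dr : ∀ r θ : ℝ, HasDerivAt (fun r : ℝ => r • unitRadial θ) (unitRadial θ) r := fun r θ => by
    simpa using (hasDerivAt_id r).smul_const (unitRadial θ)
  have dt : ∀ r θ : ℝ, HasDerivAt (fun θ : ℝ => r • unitRadial θ) (r • unitAngular θ) θ :=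
    fun r θ => (hasDerivAt_unitRadial θ).const_smul r
  have symm : ∀ x v w, fderiv ℝ (fderiv ℝ f) x v w = fderiv ℝ (fderiv ℝ f) x w v := fun x v w =>
    (hf.contDiffAt.isSymmSndFDerivAt (by simp)).eq v w
  have e0 : ∀ θ, ‖r₀ • unitRadial θ‖ = r₀ := norm_smul_unitRadial hr₀
  have e1 : ∀ θ, ‖R • unitRadial θ‖ = R := norm_smul_unitRadial hR
  { g := fun r θ => L (f (r • unitRadial θ))
    gr := fun r θ => L (fderiv ℝ f (r • unitRadial θ) (unitRadial θ))
    gt := fun r θ => L (r • fderiv ℝ f (r • unitRadial θ) (unitAngular θ))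
    grr := fun r θ => L (fderiv ℝ (fderiv ℝ f) (r • unitRadial θ) (unitRadial θ) (unitRadial θ))
    grt := fun r θ => L (fderiv ℝ f (r • unitRadial θ) (unitAngular θ)
      + r • fderiv ℝ (fderiv ℝ f) (r • unitRadial θ) (unitRadial θ) (unitAngular θ))
    gtt := fun r θ => L (-(r • fderiv ℝ f (r • unitRadial θ) (unitRadial θ))
      + r ^ 2 • fderiv ℝ (fderiv ℝ f) (r • unitRadial θ) (unitAngular θ) (unitAngular θ))
    continuous_g := L.continuous.comp c0
    continuous_gr := L.continuous.comp (c1.clm_apply cr)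
    continuous_gt := L.continuous.comp (continuous_fst.smul (c1.clm_apply ct))
    continuous_grr := L.continuous.comp ((c2.clm_apply cr).clm_apply cr)
    continuous_grt := L.continuous.comp ((c1.clm_apply ct).add
      (continuous_fst.smul ((c2.clm_apply cr).clm_apply ct)))
    continuous_gtt := L.continuous.comp ((continuous_fst.smul (c1.clm_apply cr)).neg.add
      ((continuous_fst.pow 2).smul ((c2.clm_apply ct).clm_apply ct)))
    radial_g := fun r θ => L.hasFDerivAt.comp_hasDerivAt r ((d0 _).comp_hasDerivAt r (dr r θ))
    radial_gr := fun r θ => L.hasFDerivAt.comp_hasDerivAt r (by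
      refine (((d1 _).comp_hasDerivAt r (dr r θ)).clm_apply
        (hasDerivAt_const r (unitRadial θ))).congr_deriv ?_
      simp)
    radial_gt := fun r θ => L.hasFDerivAt.comp_hasDerivAt r (by
      refine ((hasDerivAt_id r).smul (((d1 _).comp_hasDerivAt r (dr r θ)).clm_apply
        (hasDerivAt_const r (unitAngular θ)))).congr_deriv ?_
      simp [add_comm])
    angular_g := fun r θ => L.hasFDerivAt.comp_hasDerivAt θ (by
      refine ((d0 _).comp_hasDerivAt θ (dt r θ)).congr_deriv ?_
      simp)
    angular_gr := fun r θ => L.hasFDerivAt.comp_hasDerivAt θ (by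
      refine (((d1 _).comp_hasDerivAt θ (dt r θ)).clm_apply
        (hasDerivAt_unitRadial θ)).congr_deriv ?_
      simp [add_comm, symm _ (unitAngular θ)])
    angular_gt := fun r θ => L.hasFDerivAt.comp_hasDerivAt θ (by
      refine ((((d1 _).comp_hasDerivAt θ (dt r θ)).clm_apply
        (hasDerivAt_unitAngular θ)).const_smul r).congr_deriv ?_
      simp only [map_smul, map_neg, smul_apply, Function.comp]
      module)
    periodic_g := fun r => by simp only [unitRadial_neg_pi]
    periodic_gr := fun r => by simp only [unitRadial_neg_pi]
    periodic_gt := fun r => by simp only [unitRadial_neg_pi, unitAngular_neg_pi]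
    g_left := fun θ => by simp [h0 _ (e0 θ)]
    gr_left := fun θ => by simp [h0 _ (e0 θ)]
    gt_left := fun θ => by simp [h0 _ (e0 θ)]
    g_right := fun θ => by simp [h1 _ (e1 θ)]
    gr_right := fun θ => by simp [h1 _ (e1 θ)]
    gt_right := fun θ => by simp [h1 _ (e1 θ)] }

theorem polarJet_op (L : ℂ →L[ℝ] ℝ) (hf : ContDiff ℝ 2 f) {r₀ R : ℝ} (hr₀ : 0 ≤ r₀)
    (hR : 0 ≤ R) (h0 : ∀ x, ‖x‖ = r₀ → f x = 0 ∧ fderiv ℝ f x = 0)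
    (h1 : ∀ x, ‖x‖ = R → f x = 0 ∧ fderiv ℝ f x = 0) (h E : ℝ)
    (V : EuclideanSpace ℝ (Fin 2) → ℝ) {r : ℝ} (hr : r ≠ 0) (θ : ℝ) :
    (polarJet L hf hr₀ hR h0 h1).op h E (fun r θ => V (r • unitRadial θ)) r θ =
      L (-(h ^ 2 : ℝ) • lap f (r • unitRadial θ)
        + (V (r • unitRadial θ) - E) • f (r • unitRadial θ)) := by
  rw [lap_eq_polar hf _ θ]
  simp only [PolarJet.op, polarJet, map_add, map_smul, map_neg, smul_eq_mul]
  field_simp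
  ring

end Jet

section CarlemanWeights

variable {k s τ a : ℝ}

theorem phiDeriv_eq_min (r : ℝ) :
    phiDeriv k τ a r = τ * ((min r a + 1) ^ (-k) - (a + 1) ^ (-k)) := by
  unfold phiDeriv
  split_ifs with h
  · rw [min_eq_left h]
  · rw [min_eq_right (le_of_not_ge h)]
    ring

theorem radialWeight_eq_min_max (r : ℝ) :
    radialWeight k s a r = (min r a + 1) ^ (2 * k) - 1
      + (a + 1) ^ (1 - 2 * s) - (max r a + 1) ^ (1 - 2 * s) := by
  unfold radialWeight
  split_ifs with h
  · rw [min_eq_left h, max_eq_right h]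
    ring
  · rw [min_eq_right (le_of_not_ge h), max_eq_left (le_of_not_ge h)]

theorem continuousOn_phiDeriv (ha : 0 ≤ a) : ContinuousOn (phiDeriv k τ a) (Ioi (-1)) := by
  have : ContinuousOn (fun r => τ * ((min r a + 1) ^ (-k) - (a + 1) ^ (-k))) (Ioi (-1)) := by
    refine continuousOn_const.mul (ContinuousOn.sub (ContinuousOn.rpow_const (by fun_prop)
      fun r hr => Or.inl ?_) continuousOn_const)
    have : -1 < min r a := lt_min hr (by linarith)
    linarith
  exact this.congr fun r _ => phiDeriv_eq_min r

theorem continuousOn_radialWeight (ha : 0 ≤ a) : ContinuousOn (radialWeight k s a) (Ioi (-1)) := by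
  have : ContinuousOn (fun r => (min r a + 1) ^ (2 * k) - 1
      + (a + 1) ^ (1 - 2 * s) - (max r a + 1) ^ (1 - 2 * s)) (Ioi (-1)) := by
    refine ContinuousOn.sub ?_ ?_
    · refine ((ContinuousOn.rpow_const (by fun_prop) fun r hr => Or.inl ?_).sub
        continuousOn_const).add continuousOn_const
      have : -1 < min r a := lt_min hr (by linarith)
      linarith
    · refine ContinuousOn.rpow_const (by fun_prop) fun r hr => Or.inl ?_
      have := le_max_right r a
      linarith
  exact this.congr fun r _ => radialWeight_eq_min_max r

theorem hasDerivAt_add_one_rpow {r : ℝ} (hr : 0 < r) (c : ℝ) :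
    HasDerivAt (fun r : ℝ => (r + 1) ^ c) (c * (r + 1) ^ (c - 1)) r := by
  simpa [one_mul] using ((hasDerivAt_id r).add_const 1).rpow_const (p := c)
    (Or.inl (by simp only [id]; linarith))

theorem hasDerivAt_phiDeriv {r : ℝ} (hr : 0 < r) (hra : r ≠ a) :
    HasDerivAt (phiDeriv k τ a) (phiDeriv₂ k τ a r) r := by
  rcases lt_or_gt_of_ne hra with h | h
  · rw [phiDeriv₂, if_pos h.le]
    have := ((hasDerivAt_add_one_rpow hr (-k)).sub_const ((a + 1) ^ (-k))).const_mul τ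
    refine (this.congr_of_eventuallyEq ?_).congr_deriv (by ring)
    filter_upwards [Iio_mem_nhds h] with x hx
    exact if_pos (le_of_lt hx)
  · rw [phiDeriv₂, if_neg (not_le.2 h)]
    refine (hasDerivAt_const r (0 : ℝ)).congr_of_eventuallyEq ?_
    filter_upwards [Ioi_mem_nhds h] with x hx
    exact if_neg (not_le.2 hx)

theorem hasDerivAt_radialWeight {r : ℝ} (hr : 0 < r) (hra : r ≠ a) :
    HasDerivAt (radialWeight k s a) (radialWeightDeriv k s a r) r := by
  rcases lt_or_gt_of_ne hra with h | h
  · rw [radialWeightDeriv, if_pos h.le]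
    refine ((hasDerivAt_add_one_rpow hr (2 * k)).sub_const 1).congr_of_eventuallyEq ?_
    filter_upwards [Iio_mem_nhds h] with x hx
    exact if_pos (le_of_lt hx)
  · rw [radialWeightDeriv, if_neg (not_le.2 h)]
    refine (((hasDerivAt_add_one_rpow hr (1 - 2 * s)).const_sub
      ((a + 1) ^ (2 * k) - 1 + (a + 1) ^ (1 - 2 * s))).congr_of_eventuallyEq ?_).congr_deriv ?_
    · filter_upwards [Ioi_mem_nhds h] with x hx
      exact if_neg (not_le.2 hx)
    · rw [show 1 - 2 * s - 1 = -(2 * s) by ring]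
      ring

theorem hasDerivAt_phi (ha : 0 ≤ a) {r : ℝ} (hr : 0 < r) :
    HasDerivAt (phi k τ a) (phiDeriv k τ a r) r := by
  have hc := continuousOn_phiDeriv (k := k) (τ := τ) ha
  have hi : IntervalIntegrable (phiDeriv k τ a) volume 0 r := by
    refine (hc.mono fun x hx => ?_).intervalIntegrable
    rw [uIcc_of_le hr.le] at hx
    exact lt_of_lt_of_le (by norm_num) hx.1
  have hn : Ioi (-1 : ℝ) ∈ nhds r := Ioi_mem_nhds (by linarith)
  exact intervalIntegral.integral_hasDerivAt_right hi
    (hc.stronglyMeasurableAtFilter isOpen_Ioi r (by simp only [mem_Ioi]; linarith))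
    (hc.continuousAt hn)

theorem measurable_radialWeightDeriv : Measurable (radialWeightDeriv k s a) := by
  unfold radialWeightDeriv
  exact Measurable.ite measurableSet_Iic (by fun_prop) (by fun_prop)

theorem measurable_phiDeriv₂ : Measurable (phiDeriv₂ k τ a) := by
  unfold phiDeriv₂
  exact Measurable.ite measurableSet_Iic (by fun_prop) (by fun_prop)

/-- The weights of the Carleman estimate. -/
noncomputable def carlemanWeights {r₀ : ℝ} (hr₀ : 0 < r₀) (R h : ℝ) (hk : 0 < k) (hk4 : k ≤ 1 / 4)
    (hs : 1 / 2 < s) (hs1 : s ≤ 1) (hτ : 0 ≤ τ) (ha : 0 ≤ a) : EnergyWeights r₀ R a h :=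
  have hsub : Icc r₀ R ⊆ Ioi (-1) := fun r hr => lt_of_lt_of_le (by linarith) hr.1
  have hphi : ContinuousOn (phi k τ a) (Icc r₀ R) := fun r hr =>
    (hasDerivAt_phi ha (hr₀.trans_le hr.1)).continuousAt.continuousWithinAt
  { m := radialWeight k s a
    m' := radialWeightDeriv k s a
    q := phiDeriv k τ a
    q' := phiDeriv₂ k τ a
    W := fun r => r * Real.exp (2 * phi k τ a r / h)
    continuousOn_m := (continuousOn_radialWeight ha).mono hsub
    continuousOn_q := (continuousOn_phiDeriv ha).mono hsub
    continuousOn_W := continuousOn_id.mul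
      (Real.continuous_exp.comp_continuousOn ((continuousOn_const.mul hphi).div_const h))
    bounded_m' := ⟨measurable_radialWeightDeriv.aestronglyMeasurable, 1, fun r hr => by
      have hr0 : 0 ≤ r := (hr₀.trans_le hr.1).le
      rw [abs_of_nonneg (radialWeightDeriv_nonneg hk hs hr0)]
      exact radialWeightDeriv_le hk hk4 hs hs1 hr0⟩
    bounded_q' := ⟨measurable_phiDeriv₂.aestronglyMeasurable, k * τ, fun r hr =>
      abs_phiDeriv₂_le hk hτ (hr₀.trans_le hr.1).le⟩
    hasDerivAt_m := fun r hr hra => hasDerivAt_radialWeight (hr₀.trans hr.1) hra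
    hasDerivAt_q := fun r hr hra => hasDerivAt_phiDeriv (hr₀.trans hr.1) hra
    hasDerivAt_W := fun r hr => by
      have hr0 : r ≠ 0 := (hr₀.trans hr.1).ne'
      refine ((hasDerivAt_id r).mul ((((hasDerivAt_phi ha (hr₀.trans hr.1)).const_mul
        2).div_const h).exp)).congr_deriv ?_
      simp only [id]
      field_simp
      ring
    m_nonneg := fun r hr => radialWeight_nonneg hk hs ha (hr₀.trans_le hr.1).le
    W_nonneg := fun r hr => mul_nonneg (hr₀.trans_le hr.1).le (Real.exp_pos _).le }

end CarlemanWeights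

/-- Weighted Young inequality for a pair of planar vectors. -/
theorem mul_inner_le_young {b d x₁ x₂ y₁ y₂ : ℝ} (hd : 0 < d) :
    b * (x₁ * y₁ + x₂ * y₂) ≤ d * (y₁ ^ 2 + y₂ ^ 2) + b ^ 2 / (4 * d) * (x₁ ^ 2 + x₂ ^ 2) := by
  have h : d * (y₁ ^ 2 + y₂ ^ 2) + b ^ 2 / (4 * d) * (x₁ ^ 2 + x₂ ^ 2)
      - b * (x₁ * y₁ + x₂ * y₂) =
      d * ((y₁ - b / (2 * d) * x₁) ^ 2 + (y₂ - b / (2 * d) * x₂) ^ 2) := by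
    field_simp
    ring
  have : 0 ≤ d * ((y₁ - b / (2 * d) * x₁) ^ 2 + (y₂ - b / (2 * d) * x₂) ^ 2) := by positivity
  linarith

set_option maxHeartbeats 1000000 in
/-- Pointwise absorption of the cross terms in the energy estimate. -/
theorem absorb_cross_terms {E c ω m m' A M N h ε σ g₁ g₂ X₁ X₂ Q₁ Q₂ : ℝ} (hE : 0 < E) (hc : 0 < c)
    (hω : 0 < ω) (hm : 0 ≤ m) (hmA : m ≤ A) (hm' : c * ω ≤ m') (hN : N ≤ M) (hh : 0 < h)
    (hε : 0 < ε) (hε1 : ε ≤ 1) (hσ : σ = 1 ∨ σ = -1) :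
    c * min (1 / 4) (E / 16) * (ω * (X₁ ^ 2 + X₂ ^ 2 + (g₁ ^ 2 + g₂ ^ 2))) ≤
      (m' / 2 * X₁ ^ 2 + E / 8 * m' * g₁ ^ 2) + (m' / 2 * X₂ ^ 2 + E / 8 * m' * g₂ ^ 2)
      - (2 * m / h * (Q₁ * X₁) + 2 * m / h * (Q₂ * X₂))
      + A * (ε / h) * (X₁ ^ 2 + X₂ ^ 2)
      - A * (ε / h) * ((Q₁ * g₁ + N * g₁ ^ 2) + (Q₂ * g₂ + N * g₂ ^ 2))
      + 4 * A ^ 2 / c * (1 + 1 / E) / h ^ 2 *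
        (ω⁻¹ * ((Q₁ - σ * ε * g₂) ^ 2 + (Q₂ + σ * ε * g₁) ^ 2))
      + A * (1 + M) * (ε / h) * (g₁ ^ 2 + g₂ ^ 2) := by
  have hA : 0 ≤ A := hm.trans hmA
  have hm0 : 0 < m' := lt_of_lt_of_le (by positivity) hm'
  obtain ⟨P₁, hP₁⟩ : ∃ P, P = Q₁ - σ * ε * g₂ := ⟨_, rfl⟩
  obtain ⟨P₂, hP₂⟩ : ∃ P, P = Q₂ + σ * ε * g₁ := ⟨_, rfl⟩
  have eQ₁ : Q₁ = P₁ + σ * ε * g₂ := by linarith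
  have eQ₂ : Q₂ = P₂ - σ * ε * g₁ := by linarith
  rw [← hP₁, ← hP₂]
  have hinv : 1 / m' ≤ 1 / (c * ω) := one_div_le_one_div_of_le (by positivity) hm'
  have y1 := mul_inner_le_young (b := 2 * m / h) (d := m' / 4) (x₁ := P₁) (x₂ := P₂) (y₁ := X₁)
    (y₂ := X₂) (by positivity)
  have y2 := mul_inner_le_young (b := A * (ε / h)) (d := E / 16 * m') (x₁ := P₁) (x₂ := P₂)
    (y₁ := g₁) (y₂ := g₂) (by positivity)
  have b1 : (2 * m / h) ^ 2 / (4 * (m' / 4)) ≤ 4 * A ^ 2 / c / h ^ 2 * ω⁻¹ := by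
    calc (2 * m / h) ^ 2 / (4 * (m' / 4)) = 4 * m ^ 2 / h ^ 2 * (1 / m') := by field_simp; ring
      _ ≤ 4 * A ^ 2 / h ^ 2 * (1 / (c * ω)) := by gcongr
      _ = _ := by field_simp
  have b2 : (A * (ε / h)) ^ 2 / (4 * (E / 16 * m')) ≤ 4 * A ^ 2 / c * (1 / E) / h ^ 2 * ω⁻¹ := by
    calc (A * (ε / h)) ^ 2 / (4 * (E / 16 * m')) = 4 * A ^ 2 * ε ^ 2 / (E * h ^ 2) * (1 / m') := by
          field_simp; norm_num
      _ ≤ 4 * A ^ 2 * 1 / (E * h ^ 2) * (1 / (c * ω)) := by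
          have : ε ^ 2 ≤ 1 := by nlinarith
          gcongr
      _ = _ := by field_simp
  have b1' := mul_le_mul_of_nonneg_right b1 (by positivity : 0 ≤ P₁ ^ 2 + P₂ ^ 2)
  have b2' := mul_le_mul_of_nonneg_right b2 (by positivity : 0 ≤ P₁ ^ 2 + P₂ ^ 2)
  have cross : 2 * m / h * (σ * ε * (g₂ * X₁ - g₁ * X₂)) ≤
      A * (ε / h) * (X₁ ^ 2 + X₂ ^ 2 + (g₁ ^ 2 + g₂ ^ 2)) := by
    have h1 : 2 * (σ * (g₂ * X₁ - g₁ * X₂)) ≤ X₁ ^ 2 + X₂ ^ 2 + (g₁ ^ 2 + g₂ ^ 2) := by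
      rcases hσ with rfl | rfl
      · nlinarith [sq_nonneg (g₂ - X₁), sq_nonneg (g₁ + X₂)]
      · nlinarith [sq_nonneg (g₂ + X₁), sq_nonneg (g₁ - X₂)]
    calc 2 * m / h * (σ * ε * (g₂ * X₁ - g₁ * X₂))
        = m * (ε / h) * (2 * (σ * (g₂ * X₁ - g₁ * X₂))) := by ring
      _ ≤ m * (ε / h) * (X₁ ^ 2 + X₂ ^ 2 + (g₁ ^ 2 + g₂ ^ 2)) := by gcongr
      _ ≤ _ := by gcongr
  have pot : A * (ε / h) * (N * (g₁ ^ 2 + g₂ ^ 2)) ≤ A * (ε / h) * (M * (g₁ ^ 2 + g₂ ^ 2)) := by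
    gcongr
  have low1 : c * min (1 / 4) (E / 16) * (ω * (X₁ ^ 2 + X₂ ^ 2)) ≤ m' / 4 * (X₁ ^ 2 + X₂ ^ 2) := by
    calc _ ≤ c * (1 / 4) * (ω * (X₁ ^ 2 + X₂ ^ 2)) := by gcongr; exact min_le_left _ _
      _ = c * ω / 4 * (X₁ ^ 2 + X₂ ^ 2) := by ring
      _ ≤ _ := by gcongr
  have low2 : c * min (1 / 4) (E / 16) * (ω * (g₁ ^ 2 + g₂ ^ 2)) ≤
      E / 16 * m' * (g₁ ^ 2 + g₂ ^ 2) := by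
    calc _ ≤ c * (E / 16) * (ω * (g₁ ^ 2 + g₂ ^ 2)) := by gcongr; exact min_le_right _ _
      _ = E / 16 * (c * ω) * (g₁ ^ 2 + g₂ ^ 2) := by ring
      _ ≤ _ := by gcongr
  have e1 : 4 * A ^ 2 / c * (1 + 1 / E) / h ^ 2 * (ω⁻¹ * (P₁ ^ 2 + P₂ ^ 2)) =
      4 * A ^ 2 / c / h ^ 2 * ω⁻¹ * (P₁ ^ 2 + P₂ ^ 2)
      + 4 * A ^ 2 / c * (1 / E) / h ^ 2 * ω⁻¹ * (P₁ ^ 2 + P₂ ^ 2) := by ring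
  have e2 : A * (1 + M) * (ε / h) * (g₁ ^ 2 + g₂ ^ 2) =
      A * (ε / h) * (g₁ ^ 2 + g₂ ^ 2) + A * (ε / h) * (M * (g₁ ^ 2 + g₂ ^ 2)) := by ring
  rw [e1, e2, eQ₁, eQ₂]
  clear e1 e2 b1 b2 hP₁ hP₂ eQ₁ eQ₂
  generalize 4 * A ^ 2 / c / h ^ 2 * ω⁻¹ * (P₁ ^ 2 + P₂ ^ 2) = K₁ at *
  generalize 4 * A ^ 2 / c * (1 / E) / h ^ 2 * ω⁻¹ * (P₁ ^ 2 + P₂ ^ 2) = K₂ at *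
  generalize (2 * m / h) ^ 2 / (4 * (m' / 4)) * (P₁ ^ 2 + P₂ ^ 2) = J₁ at *
  generalize (A * (ε / h)) ^ 2 / (4 * (E / 16 * m')) * (P₁ ^ 2 + P₂ ^ 2) = J₂ at *
  generalize 2 * m / h = b at *
  generalize A * (ε / h) = α at *
  generalize c * min (1 / 4) (E / 16) = κ at *
  linear_combination y1 + y2 + b1' + b2' + cross + pot + low1 + low2

section Combine

variable {r₀ R a h E : ℝ}

/-- The weighted estimate in polar coordinates for a pair of functions, the real and imaginary
parts of a complex function. -/
theorem PolarJet.pair_estimate (u₁ u₂ : PolarJet r₀ R) (w : EnergyWeights r₀ R a h)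
    {v : ℝ → ℝ → ℝ} {ω : ℝ → ℝ} {c A M ε σ : ℝ}
    (hE : 0 < E) (hh : 0 < h) (hr₀ : 0 < r₀) (hR : r₀ ≤ R)
    (hv : BoundedMeasurableOn (fun x : ℝ × ℝ => v x.1 x.2) (polarRect r₀ R))
    (hvac : ∀ θ, AbsolutelyContinuousOnInterval (fun r => v r θ) r₀ R)
    {B : ℝ → ℝ} (hB : ContinuousOn B (Icc r₀ R))
    (hvB : ∀ θ, ∀ᵐ r, r ∈ Icc r₀ R → deriv (fun r => v r θ) r ≤ B r)
    (hcone : ∀ r ∈ Icc r₀ R, r * w.m' r ≤ 2 * w.m r)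
    (hpos : ∀ r ∈ Icc r₀ R, ∀ θ X Y : ℝ,
      w.m' r / 2 * X ^ 2 + E / 8 * w.m' r * Y ^ 2 ≤
        (w.m' r + 4 * w.q r * w.m r / h) * X ^ 2
      + (w.m' r * (E + w.q r ^ 2) + 2 * w.m r * w.q r * w.q' r
        - h ^ 2 / (4 * r ^ 2) * (2 * w.m r / r - w.m' r) - w.m' r * v r θ - B r * w.m r) * Y ^ 2
      + 2 * w.m r * w.q' r * Y * X)
    (hω : ∀ r ∈ Icc r₀ R, 0 < ω r) (hωc : ContinuousOn ω (Icc r₀ R)) (hc : 0 < c)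
    (hm' : ∀ r ∈ Icc r₀ R, c * ω r ≤ w.m' r) (hmA : ∀ r ∈ Icc r₀ R, w.m r ≤ A)
    (hM : ∀ r ∈ Icc r₀ R, ∀ θ, E + w.q r ^ 2 - v r θ + h ^ 2 / (4 * r ^ 2) ≤ M)
    (hε : 0 < ε) (hε1 : ε ≤ 1) (hσ : σ = 1 ∨ σ = -1) :
    c * min (1 / 4) (E / 16) * ∫ x in polarRect r₀ R, w.W x.1 * (ω x.1 *
      ((h * u₁.conj w x.1 x.2) ^ 2 + (h * u₂.conj w x.1 x.2) ^ 2
        + (u₁.g x.1 x.2 ^ 2 + u₂.g x.1 x.2 ^ 2))) ≤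
    4 * A ^ 2 / c * (1 + 1 / E) / h ^ 2 * (∫ x in polarRect r₀ R, w.W x.1 * ((ω x.1)⁻¹ *
      ((u₁.op h E v x.1 x.2 - σ * ε * u₂.g x.1 x.2) ^ 2
        + (u₂.op h E v x.1 x.2 + σ * ε * u₁.g x.1 x.2) ^ 2)))
    + A * (1 + M) * (ε / h) * ∫ x in polarRect r₀ R, w.W x.1 *
      (u₁.g x.1 x.2 ^ 2 + u₂.g x.1 x.2 ^ 2) := by
  have ch := isPolarChart_rect r₀ R
  have bm := ch.continuousOn w.continuousOn_m
  have bq := ch.continuousOn w.continuousOn_q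
  have bW := ch.continuousOn w.continuousOn_W
  have bm' := ch.radial _ w.bounded_m'
  have bi := ch.inv hr₀
  have bω := ch.continuousOn hωc
  have bωi := ch.continuousOn (hωc.inv₀ fun r hr => (hω r hr).ne')
  have bg₁ := ch.joint _ u₁.continuous_g
  have bg₂ := ch.joint _ u₂.continuous_g
  have bp₁ := (BoundedMeasurableOn.const h).mul (u₁.bounded_conj w ch hr₀)
  have bp₂ := (BoundedMeasurableOn.const h).mul (u₂.bounded_conj w ch hr₀)
  have bo₁ := u₁.bounded_op (h := h) (E := E) ch hr₀ hv
  have bo₂ := u₂.bounded_op (h := h) (E := E) ch hr₀ hv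
  have bN : BoundedMeasurableOn (fun x : ℝ × ℝ => E + w.q x.1 ^ 2 - v x.1 x.2
      + h ^ 2 / (4 * x.1 ^ 2)) (polarRect r₀ R) := by
    simp only [div_eq_mul_inv, mul_inv, ← inv_pow]
    exact (((BoundedMeasurableOn.const E).add (bq.pow 2)).sub hv).add
      ((BoundedMeasurableOn.const (h ^ 2)).mul ((BoundedMeasurableOn.const _).mul (bi.pow 2)))
  have bL : ∀ u : PolarJet r₀ R, BoundedMeasurableOn (fun x : ℝ × ℝ => w.W x.1 *
      (w.m' x.1 / 2 * (h * u.conj w x.1 x.2) ^ 2 + E / 8 * w.m' x.1 * u.g x.1 x.2 ^ 2))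
      (polarRect r₀ R) := fun u => by
    simp only [div_eq_mul_inv]
    exact bW.mul (((bm'.mul (.const _)).mul (((BoundedMeasurableOn.const _).mul
      (u.bounded_conj w ch hr₀)).pow 2)).add
      (((BoundedMeasurableOn.const _).mul bm').mul ((ch.joint _ u.continuous_g).pow 2)))
  have bQ : ∀ u : PolarJet r₀ R, BoundedMeasurableOn (fun x : ℝ × ℝ => 2 * w.m x.1 * w.W x.1 *
      u.op h E v x.1 x.2 * u.conj w x.1 x.2) (polarRect r₀ R) := fun u =>
    ((((BoundedMeasurableOn.const _).mul bm).mul bW).mul (u.bounded_op ch hr₀ hv)).mul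
      (u.bounded_conj w ch hr₀)
  have bX : ∀ u : PolarJet r₀ R, BoundedMeasurableOn (fun x : ℝ × ℝ => w.W x.1 *
      (h * u.conj w x.1 x.2) ^ 2) (polarRect r₀ R) := fun u =>
    bW.mul (((BoundedMeasurableOn.const _).mul (u.bounded_conj w ch hr₀)).pow 2)
  have bZ : ∀ u : PolarJet r₀ R, BoundedMeasurableOn (fun x : ℝ × ℝ => w.W x.1 *
      (u.op h E v x.1 x.2 * u.g x.1 x.2
        + (E + w.q x.1 ^ 2 - v x.1 x.2 + h ^ 2 / (4 * x.1 ^ 2)) * u.g x.1 x.2 ^ 2))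
      (polarRect r₀ R) := fun u =>
    bW.mul (((u.bounded_op ch hr₀ hv).mul (ch.joint _ u.continuous_g)).add
      (bN.mul ((ch.joint _ u.continuous_g).pow 2)))
  have bK : BoundedMeasurableOn (fun x : ℝ × ℝ => w.W x.1 * (ω x.1 *
      ((h * u₁.conj w x.1 x.2) ^ 2 + (h * u₂.conj w x.1 x.2) ^ 2
        + (u₁.g x.1 x.2 ^ 2 + u₂.g x.1 x.2 ^ 2)))) (polarRect r₀ R) :=
    bW.mul (bω.mul (((bp₁.pow 2).add (bp₂.pow 2)).add ((bg₁.pow 2).add (bg₂.pow 2))))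
  have bP : BoundedMeasurableOn (fun x : ℝ × ℝ => w.W x.1 * ((ω x.1)⁻¹ *
      ((u₁.op h E v x.1 x.2 - σ * ε * u₂.g x.1 x.2) ^ 2
        + (u₂.op h E v x.1 x.2 + σ * ε * u₁.g x.1 x.2) ^ 2))) (polarRect r₀ R) :=
    bW.mul (bωi.mul (((bo₁.sub ((BoundedMeasurableOn.const _).mul bg₂)).pow 2).add
      ((bo₂.add ((BoundedMeasurableOn.const _).mul bg₁)).pow 2)))
  have bG : BoundedMeasurableOn (fun x : ℝ × ℝ => w.W x.1 *
      (u₁.g x.1 x.2 ^ 2 + u₂.g x.1 x.2 ^ 2)) (polarRect r₀ R) :=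
    bW.mul ((bg₁.pow 2).add (bg₂.pow 2))
  have hA : 0 ≤ A := (w.m_nonneg r₀ ⟨le_rfl, hR⟩).trans (hmA r₀ ⟨le_rfl, hR⟩)
  have e₁ := u₁.energy_estimate w hh hr₀ hR hv hvac hB hvB hcone hpos
  have e₂ := u₂.energy_estimate w hh hr₀ hR hv hvac hB hvB hcone hpos
  have f₁ := mul_le_mul_of_nonneg_left (u₁.conj_estimate (E := E) w hh hr₀ hR hv)
    (by positivity : 0 ≤ A * (ε / h))
  have f₂ := mul_le_mul_of_nonneg_left (u₂.conj_estimate (E := E) w hh hr₀ hR hv)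
    (by positivity : 0 ≤ A * (ε / h))
  have iL := fun u => (bL u).polarRect_integrable
  have iQ := fun u => (bQ u).polarRect_integrable
  have iX := fun u => (bX u).polarRect_integrable.const_mul (A * (ε / h))
  have iZ := fun u => (bZ u).polarRect_integrable.const_mul (A * (ε / h))
  have iP := bP.polarRect_integrable.const_mul (4 * A ^ 2 / c * (1 + 1 / E) / h ^ 2)
  have iG := bG.polarRect_integrable.const_mul (A * (1 + M) * (ε / h))
  have i1 := (iL u₁).add (iL u₂)
  have i2 := i1.sub ((iQ u₁).add (iQ u₂))
  have i3 := i2.add ((iX u₁).add (iX u₂))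
  have i4 := i3.sub ((iZ u₁).add (iZ u₂))
  have i5 := i4.add iP
  have i6 := i5.add iG
  have key := setIntegral_mono_on (bK.polarRect_integrable.const_mul (c * min (1 / 4) (E / 16))) i6
    (measurableSet_polarRect r₀ R) fun x hx => by
      have := mul_le_mul_of_nonneg_left (absorb_cross_terms (g₁ := u₁.g x.1 x.2)
        (g₂ := u₂.g x.1 x.2) (X₁ := h * u₁.conj w x.1 x.2) (X₂ := h * u₂.conj w x.1 x.2)
        (Q₁ := u₁.op h E v x.1 x.2) (Q₂ := u₂.op h E v x.1 x.2) hE hc (hω _ hx.1)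
        (w.m_nonneg _ hx.1) (hmA _ hx.1) (hm' _ hx.1) (hM _ hx.1 x.2) hh hε hε1 hσ)
        (w.W_nonneg _ hx.1)
      simp only [Pi.add_apply, Pi.sub_apply]
      have hQ : ∀ u : PolarJet r₀ R, 2 * w.m x.1 * w.W x.1 * u.op h E v x.1 x.2 * u.conj w x.1 x.2
          = w.W x.1 * (2 * w.m x.1 / h * (u.op h E v x.1 x.2 * (h * u.conj w x.1 x.2))) :=
        fun u => by field_simp
      rw [hQ u₁, hQ u₂]
      linear_combination this
  rw [integral_const_mul] at key
  refine key.trans ?_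
  rw [integral_add' i5 iG, integral_add' i4 iP, integral_sub' i3 ((iZ u₁).add (iZ u₂)),
    integral_add' i2 ((iX u₁).add (iX u₂)), integral_sub' i1 ((iQ u₁).add (iQ u₂)),
    integral_add' (iL u₁) (iL u₂), integral_add' (iQ u₁) (iQ u₂), integral_add' (iX u₁) (iX u₂),
    integral_add' (iZ u₁) (iZ u₂)]
  simp only [integral_const_mul]
  linarith

end Combine

/-- Polar coordinates for an integral over the exterior of a disc. -/
theorem setIntegral_exterior_eq_polarRect {r₀ R : ℝ} (hr₀ : 0 < r₀)
    {Φ : EuclideanSpace ℝ (Fin 2) → ℝ} (hΦ : ∀ x, R < ‖x‖ → Φ x = 0) :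
    ∫ x in {x : EuclideanSpace ℝ (Fin 2) | r₀ ≤ ‖x‖}, Φ x =
      ∫ y in polarRect r₀ R, y.1 * Φ (y.1 • unitRadial y.2) := by
  have hS : MeasurableSet {x : EuclideanSpace ℝ (Fin 2) | r₀ ≤ ‖x‖} :=
    (isClosed_le continuous_const continuous_norm).measurableSet
  rw [← integral_indicator hS]
  set Ψ := ({x : EuclideanSpace ℝ (Fin 2) | r₀ ≤ ‖x‖}).indicator Φ with hΨ
  have h1 : ∫ x, Ψ x = ∫ y : ℝ × ℝ, Ψ (WithLp.toLp 2 ![y.1, y.2]) := by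
    have e1 := (EuclideanSpace.volume_preserving_symm_measurableEquiv_toLp (Fin 2)).symm
    have e2 := (volume_preserving_finTwoArrow ℝ).symm
    rw [← e1.integral_comp' Ψ, ← e2.integral_comp']
    rfl
  rw [h1, ← integral_comp_polarCoord_symm]
  have h2 : ∀ y : ℝ × ℝ, (WithLp.toLp 2 ![(polarCoord.symm y).1, (polarCoord.symm y).2] :
      EuclideanSpace ℝ (Fin 2)) = y.1 • unitRadial y.2 := by
    intro y
    ext i
    fin_cases i <;> simp [unitRadial]
  simp only [h2, smul_eq_mul]
  have hpi := Real.pi_pos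
  have h3 : ∫ y in polarCoord.target, y.1 * Ψ (y.1 • unitRadial y.2) =
      ∫ y in Icc r₀ R ×ˢ Ioo (-Real.pi) Real.pi, y.1 * Ψ (y.1 • unitRadial y.2) := by
    rw [polarCoord_target]
    refine setIntegral_eq_of_subset_of_forall_sdiff_eq_zero
      (measurableSet_Ioi.prod measurableSet_Ioo)
      (prod_mono (fun r hr => hr₀.trans_le hr.1) subset_rfl) fun y hy => ?_
    have hy0 : 0 < y.1 := hy.1.1
    have hn : ‖y.1 • unitRadial y.2‖ = y.1 := norm_smul_unitRadial hy0.le _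
    refine mul_eq_zero_of_right _ ?_
    by_cases h : r₀ ≤ y.1
    · refine (indicator_apply_eq_zero).2 fun _ => hΦ _ ?_
      rw [hn]
      by_contra! h'
      exact hy.2 ⟨⟨h, h'⟩, hy.1.2⟩
    · refine indicator_of_notMem ?_ _
      rw [mem_ofPred_eq, hn]
      exact h
  have h4 : ∫ y in Icc r₀ R ×ˢ Ioo (-Real.pi) Real.pi, y.1 * Ψ (y.1 • unitRadial y.2) =
      ∫ y in polarRect r₀ R, y.1 * Ψ (y.1 • unitRadial y.2) :=
    setIntegral_congr_set (Measure.set_prod_ae_eq (ae_eq_refl _) Ioo_ae_eq_Icc)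
  rw [h3, h4]
  refine setIntegral_congr_fun (measurableSet_polarRect r₀ R) fun y hy => ?_
  have hy0 : 0 < y.1 := hr₀.trans_le hy.1.1
  rw [hΨ, indicator_of_mem]
  rw [mem_ofPred_eq, norm_smul_unitRadial hy0.le]
  exact hy.1.1

section Conclusion

variable {r₀ R a h : ℝ}

/-- The weighted norms of a function and of its radial derivative are controlled by that of the
conjugated radial derivative. -/
theorem PolarJet.integral_weighted_le (u₁ u₂ : PolarJet r₀ R) (w : EnergyWeights r₀ R a h)
    {ω : ℝ → ℝ} {N : ℝ} (hr₀ : 0 < r₀) (hh : 0 < h) (hω : ∀ r ∈ Icc r₀ R, 0 < ω r)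
    (hωc : ContinuousOn ω (Icc r₀ R)) (hN : ∀ r ∈ Icc r₀ R, |w.q r + h / (2 * r)| ≤ N) :
    (∫ x in polarRect r₀ R, w.W x.1 * (ω x.1 * (u₁.g x.1 x.2 ^ 2 + u₂.g x.1 x.2 ^ 2)) ≤
      2 * (1 + N ^ 2) * ∫ x in polarRect r₀ R, w.W x.1 * (ω x.1 *
        ((h * u₁.conj w x.1 x.2) ^ 2 + (h * u₂.conj w x.1 x.2) ^ 2
          + (u₁.g x.1 x.2 ^ 2 + u₂.g x.1 x.2 ^ 2)))) ∧
    ∫ x in polarRect r₀ R, w.W x.1 * (ω x.1 * ((h * u₁.gr x.1 x.2) ^ 2 + (h * u₂.gr x.1 x.2) ^ 2)) ≤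
      2 * (1 + N ^ 2) * ∫ x in polarRect r₀ R, w.W x.1 * (ω x.1 *
        ((h * u₁.conj w x.1 x.2) ^ 2 + (h * u₂.conj w x.1 x.2) ^ 2
          + (u₁.g x.1 x.2 ^ 2 + u₂.g x.1 x.2 ^ 2))) := by
  have ch := isPolarChart_rect r₀ R
  have bW := ch.continuousOn w.continuousOn_W
  have bω := ch.continuousOn hωc
  have bg := ((ch.joint _ u₁.continuous_g).pow 2).add ((ch.joint _ u₂.continuous_g).pow 2)
  have bc : ∀ u : PolarJet r₀ R, BoundedMeasurableOn
      (fun x : ℝ × ℝ => (h * u.conj w x.1 x.2) ^ 2) (polarRect r₀ R) := fun u =>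
    ((BoundedMeasurableOn.const h).mul (u.bounded_conj w ch hr₀)).pow 2
  have br : ∀ u : PolarJet r₀ R, BoundedMeasurableOn
      (fun x : ℝ × ℝ => (h * u.gr x.1 x.2) ^ 2) (polarRect r₀ R) := fun u =>
    ((BoundedMeasurableOn.const h).mul (ch.joint _ u.continuous_gr)).pow 2
  have i0 := (bW.mul (bω.mul (((bc u₁).add (bc u₂)).add bg))).polarRect_integrable
  have hmono : ∀ {F : ℝ × ℝ → ℝ}, BoundedMeasurableOn F (polarRect r₀ R) →
      (∀ x ∈ polarRect r₀ R, F x ≤ 2 * (1 + N ^ 2) * ((h * u₁.conj w x.1 x.2) ^ 2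
        + (h * u₂.conj w x.1 x.2) ^ 2 + (u₁.g x.1 x.2 ^ 2 + u₂.g x.1 x.2 ^ 2))) →
      ∫ x in polarRect r₀ R, w.W x.1 * (ω x.1 * F x) ≤
        2 * (1 + N ^ 2) * ∫ x in polarRect r₀ R, w.W x.1 * (ω x.1 *
          ((h * u₁.conj w x.1 x.2) ^ 2 + (h * u₂.conj w x.1 x.2) ^ 2
            + (u₁.g x.1 x.2 ^ 2 + u₂.g x.1 x.2 ^ 2))) := by
    intro F bF hF
    rw [← integral_const_mul]
    refine setIntegral_mono_on (bW.mul (bω.mul bF)).polarRect_integrable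
      (i0.const_mul _) (measurableSet_polarRect r₀ R) fun x hx => ?_
    have := mul_le_mul_of_nonneg_left (mul_le_mul_of_nonneg_left (hF x hx) (hω _ hx.1).le)
      (w.W_nonneg _ hx.1)
    linarith
  have hc : ∀ u : PolarJet r₀ R, ∀ x ∈ polarRect r₀ R, (h * u.gr x.1 x.2) ^ 2 ≤
      2 * (h * u.conj w x.1 x.2) ^ 2 + 2 * N ^ 2 * u.g x.1 x.2 ^ 2 := by
    intro u x hx
    have hx0 : x.1 ≠ 0 := (hr₀.trans_le hx.1.1).ne'
    have e : h * u.gr x.1 x.2 =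
        h * u.conj w x.1 x.2 - (w.q x.1 + h / (2 * x.1)) * u.g x.1 x.2 := by
      rw [PolarJet.conj]
      field_simp
      ring
    have h1 : (w.q x.1 + h / (2 * x.1)) ^ 2 ≤ N ^ 2 := sq_le_sq.2 ((hN _ hx.1).trans (le_abs_self N))
    rw [e]
    nlinarith [sq_nonneg (h * u.conj w x.1 x.2 + (w.q x.1 + h / (2 * x.1)) * u.g x.1 x.2),
      mul_le_mul_of_nonneg_right h1 (sq_nonneg (u.g x.1 x.2))]
  constructor
  · refine hmono bg fun x _ => ?_
    nlinarith [mul_nonneg (sq_nonneg N) (sq_nonneg (h * u₁.conj w x.1 x.2)),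
      mul_nonneg (sq_nonneg N) (sq_nonneg (h * u₂.conj w x.1 x.2)),
      mul_nonneg (sq_nonneg N) (sq_nonneg (u₁.g x.1 x.2)),
      mul_nonneg (sq_nonneg N) (sq_nonneg (u₂.g x.1 x.2)), sq_nonneg (h * u₁.conj w x.1 x.2),
      sq_nonneg (h * u₂.conj w x.1 x.2), sq_nonneg (u₁.g x.1 x.2), sq_nonneg (u₂.g x.1 x.2)]
  · refine hmono ((br u₁).add (br u₂)) fun x hx => ?_
    nlinarith [mul_nonneg (sq_nonneg N) (sq_nonneg (h * u₁.conj w x.1 x.2)),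
      mul_nonneg (sq_nonneg N) (sq_nonneg (h * u₂.conj w x.1 x.2)), hc u₁ x hx, hc u₂ x hx,
      sq_nonneg (u₁.g x.1 x.2), sq_nonneg (u₂.g x.1 x.2)]

theorem sqrt_add_sqrt_le_of_le {G D P Q K S α γ ε : ℝ} (hh : 0 < h) (hε : 0 < ε)
    (hK : 0 ≤ K) (hP : 0 ≤ P) (hQ : 0 ≤ Q) (hα : 2 * √K ≤ α) (hγ : 2 * √K ≤ γ)
    (hS : S ≤ K * (P / h ^ 2 + ε / h * Q)) (hG : G ≤ S) (hD : D ≤ S) :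
    √G + √D ≤ α * h⁻¹ * √P + γ * √(ε / h) * √Q := by
  have h1 : √(K * (P / h ^ 2 + ε / h * Q)) ≤ √K * (h⁻¹ * √P + √(ε / h) * √Q) := by
    rw [Real.sqrt_mul hK]
    refine mul_le_mul_of_nonneg_left (Real.sqrt_le_iff.2 ⟨by positivity, ?_⟩) (Real.sqrt_nonneg _)
    have e1 := Real.sq_sqrt hP
    have e2 := Real.sq_sqrt hQ
    have e3 := Real.sq_sqrt (by positivity : 0 ≤ ε / h)
    have e4 : P / h ^ 2 + ε / h * Q = (h⁻¹ * √P) ^ 2 + (√(ε / h) * √Q) ^ 2 := by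
      rw [mul_pow, mul_pow, e1, e2, e3]
      field_simp
    rw [e4]
    have : 0 ≤ h⁻¹ * √P * (√(ε / h) * √Q) := by positivity
    linarith
  have h2 := (Real.sqrt_le_sqrt (hG.trans hS)).trans h1
  have h3 := (Real.sqrt_le_sqrt (hD.trans hS)).trans h1
  have h4 := mul_le_mul_of_nonneg_right hα (by positivity : 0 ≤ h⁻¹ * √P)
  have h5 := mul_le_mul_of_nonneg_right hγ (by positivity : 0 ≤ √(ε / h) * √Q)
  linarith

end Conclusion

theorem setIntegral_exterior_mul_mul_eq_polarRect {r₀ R : ℝ} (hr₀ : 0 < r₀) (ω e : ℝ → ℝ)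
    {F : EuclideanSpace ℝ (Fin 2) → ℝ} (hF : ∀ x, R < ‖x‖ → F x = 0) :
    ∫ x in {x : EuclideanSpace ℝ (Fin 2) | r₀ ≤ ‖x‖}, ω ‖x‖ * e ‖x‖ * F x =
      ∫ y in polarRect r₀ R, y.1 * e y.1 * (ω y.1 * F (y.1 • unitRadial y.2)) := by
  rw [setIntegral_exterior_eq_polarRect hr₀ fun x hx => by rw [hF x hx, mul_zero]]
  refine setIntegral_congr_fun (measurableSet_polarRect r₀ R) fun y hy => ?_
  rw [norm_smul_unitRadial (hr₀.trans_le hy.1.1).le]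
  ring

theorem exists_forall_norm_ge_fderiv_eq_zero {f : EuclideanSpace ℝ (Fin 2) → ℂ}
    (hf : HasCompactSupport f) (r₀ : ℝ) :
    ∃ R, r₀ < R ∧ ∀ x, R ≤ ‖x‖ → f x = 0 ∧ fderiv ℝ f x = 0 ∧ lap f x = 0 := by
  obtain ⟨R, hR⟩ := hf.isCompact.isBounded.subset_ball_lt r₀ 0
  refine ⟨R, hR.1, fun x hx => ?_⟩
  have hx' : x ∉ tsupport f := fun h => by
    have := hR.2 h
    rw [mem_ball_zero_iff] at this
    linarith
  have h0 : f =ᶠ[nhds x] fun _ => 0 := notMem_tsupport_iff_eventuallyEq.1 hx'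
  have h1 : fderiv ℝ f =ᶠ[nhds x] fun _ => 0 := by
    filter_upwards [h0.eventuallyEq_nhds] with y hy
    rw [hy.fderiv_eq, fderiv_fun_const, Pi.zero_apply]
  refine ⟨h0.eq_of_nhds, h1.eq_of_nhds, Finset.sum_eq_zero fun i _ => ?_⟩
  have h2 : (fun y => fderiv ℝ f y (EuclideanSpace.single i 1)) =ᶠ[nhds x] fun _ => 0 := by
    filter_upwards [h1] with y hy
    rw [hy, zero_apply]
  rw [h2.fderiv_eq, fderiv_fun_const, Pi.zero_apply, zero_apply]

theorem Complex.sq_norm_eq (z : ℂ) : ‖z‖ ^ 2 = z.re ^ 2 + z.im ^ 2 := by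
  rw [Complex.sq_norm, Complex.normSq_apply]
  ring

theorem sq_norm_radialDeriv (h : ℝ) (f : EuclideanSpace ℝ (Fin 2) → ℂ) {r : ℝ} (hr : 0 < r) (θ : ℝ) :
    ‖radialDeriv h f (r • unitRadial θ)‖ ^ 2 =
      (h * (fderiv ℝ f (r • unitRadial θ) (unitRadial θ)).re) ^ 2
        + (h * (fderiv ℝ f (r • unitRadial θ) (unitRadial θ)).im) ^ 2 := by
  rw [radialDeriv, norm_smul_unitRadial hr.le, smul_smul, inv_mul_cancel₀ hr.ne', one_smul,
    Complex.sq_norm_eq]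
  simp
  ring

/-- The exterior-domain Carleman estimate of Theorem 4.2 in dimension d = 2 for
potentials Lipschitz in the radial variable, valid for all 0 < h ≤ 1. -/
theorem stmt_18 (E r₀ : ℝ) (hE : 0 < E) (hr₀ : 0 < r₀)
    (V : EuclideanSpace ℝ (Fin 2) → ℝ) (hVb : ∃ M, ∀ x, |V x| ≤ M) (hVm : Measurable V)
    (hV0 : ∀ x : EuclideanSpace ℝ (Fin 2), ‖x‖ ≤ r₀ / 3 → V x = 0)
    (p : ℝ → ℝ) (hp_pos : ∀ r : ℝ, 0 ≤ r → 0 < p r)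
    (hp_mono : ∀ r r' : ℝ, 0 ≤ r → r ≤ r' → p r' ≤ p r)
    (hp_lim : Filter.Tendsto p Filter.atTop (nhds 0))
    (hVp : ∀ x, V x ≤ p ‖x‖)
    (C₂ β : ℝ) (hC₂ : 0 < C₂) (hβ : 1 < β)
    (hVlip : ∀ w : EuclideanSpace ℝ (Fin 2), ‖w‖ = 1 → ∀ b : ℝ, 0 < b →
      ∃ K : NNReal, LipschitzOnWith K (fun r : ℝ => V (r • w)) (Set.Icc 0 b))
    (hVderiv : ∀ w : EuclideanSpace ℝ (Fin 2), ‖w‖ = 1 →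
      ∀ᵐ r ∂(volume.restrict (Set.Ici (0:ℝ))),
        deriv (fun t : ℝ => V (t • w)) r ≤ C₂ * (r + 1) ^ (-β))
    (k s ℓ : ℝ) (hk : k = 1/4 * min 1 (β - 1))
    (hs1 : 1/2 < s) (hs2 : s < 1/4 * min 3 (β + 1))
    (hℓ1 : k * ℓ > 2) (hℓ2 : (β - 2*k - 2*s) * ℓ > 2) :
    ∃ τ₀ : ℝ, 1 ≤ τ₀ ∧ ∃ C > 0, ∀ h ε : ℝ, 0 < h → h ≤ 1 → 0 < ε → ε ≤ 1 →
      ∀ τ a : ℝ, τ = τ₀ → a = τ₀ ^ ℓ →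
        ∀ sgn : ℝ, (sgn = 1 ∨ sgn = -1) →
          ∀ f : EuclideanSpace ℝ (Fin 2) → ℂ, ContDiff ℝ (⊤ : ℕ∞) f → HasCompactSupport f →
            (∀ x : EuclideanSpace ℝ (Fin 2), ‖x‖ = r₀ → f x = 0 ∧ fderiv ℝ f x = 0) →
            Real.sqrt (∫ x in {x : EuclideanSpace ℝ (Fin 2) | r₀ ≤ ‖x‖},
                  (‖x‖ + 1) ^ (-(2*s)) * Real.exp (2 * phi k τ a ‖x‖ / h) * ‖f x‖ ^ 2)
              + Real.sqrt (∫ x in {x : EuclideanSpace ℝ (Fin 2) | r₀ ≤ ‖x‖},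
                  (‖x‖ + 1) ^ (-(2*s)) * Real.exp (2 * phi k τ a ‖x‖ / h)
                    * ‖radialDeriv h f x‖ ^ 2)
            ≤ C * a ^ 2 * h⁻¹ *
                Real.sqrt (∫ x in {x : EuclideanSpace ℝ (Fin 2) | r₀ ≤ ‖x‖},
                  (‖x‖ + 1) ^ (2*s) * Real.exp (2 * phi k τ a ‖x‖ / h) *
                    ‖-(h:ℂ)^2 * lap f x
                      + ((V x : ℂ) - (E:ℂ) + (sgn:ℂ) * (ε:ℂ) * Complex.I) * f x‖ ^ 2)
              + C * τ * a * Real.sqrt (ε / h) *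
                Real.sqrt (∫ x in {x : EuclideanSpace ℝ (Fin 2) | r₀ ≤ ‖x‖},
                  Real.exp (2 * phi k τ a ‖x‖ / h) * ‖f x‖ ^ 2) := by
  have hk0 : 0 < k := by
    rw [hk]
    have : 0 < min 1 (β - 1) := lt_min one_pos (by linarith)
    linarith
  have hk4 : k ≤ 1 / 4 := by linarith [min_le_left 1 (β - 1)]
  have hkβ : 4 * k ≤ β - 1 := by linarith [min_le_right 1 (β - 1)]
  have hs3 : s < 3 / 4 := by linarith [min_le_left 3 (β + 1)]
  have hs' : s ≤ 1 := by linarith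
  have hℓ : 0 < ℓ := by
    by_contra! h
    nlinarith
  have hβ' : 2 * k + 2 * s < β := by
    by_contra! h
    nlinarith
  obtain ⟨τ, hτ, hcar⟩ := exists_carleman_parameter (ℓ := ℓ) hE hr₀ hp_pos hp_mono hp_lim hC₂ hk0 hk4 hkβ
    hs1 hs3 hℓ1 hβ'
  obtain ⟨B, hB⟩ := hVb
  have hB0 : 0 ≤ B := (abs_nonneg _).trans (hB 0)
  obtain ⟨a, ha⟩ : ∃ a, a = τ ^ ℓ := ⟨_, rfl⟩
  have ha1 : 1 ≤ a := ha ▸ Real.one_le_rpow hτ hℓ.le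
  have hτ0 : 0 ≤ τ := by linarith
  have ha0 : 0 ≤ a := by linarith
  obtain ⟨c, hc⟩ : ∃ c, c = min (2 * k) (2 * s - 1) := ⟨_, rfl⟩
  have hc0 : 0 < c := hc ▸ lt_min (by linarith) (by linarith)
  obtain ⟨A, hA⟩ : ∃ A, A = (a + 1) ^ (2 * k) := ⟨_, rfl⟩
  have hA0 : 0 < A := by rw [hA]; positivity
  obtain ⟨M, hM⟩ : ∃ M, M = E + τ ^ 2 + B + 1 / (4 * r₀ ^ 2) := ⟨_, rfl⟩
  have hM0 : 0 < M := by rw [hM]; positivity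
  obtain ⟨N, hN⟩ : ∃ N, N = τ + 1 / (2 * r₀) := ⟨_, rfl⟩
  obtain ⟨κ, hκ⟩ : ∃ κ, κ = c * min (1 / 4) (E / 16) := ⟨_, rfl⟩
  have hκ0 : 0 < κ := hκ ▸ mul_pos hc0 (lt_min (by norm_num) (by positivity))
  obtain ⟨K₁, hK₁⟩ : ∃ K₁, K₁ = 4 * A ^ 2 / c * (1 + 1 / E) := ⟨_, rfl⟩
  obtain ⟨K₂, hK₂⟩ : ∃ K₂, K₂ = A * (1 + M) := ⟨_, rfl⟩
  have hK₁0 : 0 < K₁ := by rw [hK₁]; positivity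
  have hK₂0 : 0 < K₂ := by rw [hK₂]; positivity
  obtain ⟨K, hK⟩ : ∃ K, K = 2 * (1 + N ^ 2) * ((K₁ + K₂) / κ) := ⟨_, rfl⟩
  have hK0 : 0 < K := by rw [hK]; positivity
  have hsK : 0 < √K := Real.sqrt_pos.2 hK0
  refine ⟨τ, hτ, 2 * √K, by positivity, ?_⟩
  rintro h ε hh hh1 hε hε1 τ' a' rfl ha' σ hσ f hf hfc hf0
  obtain rfl : a' = a := ha'.trans ha.symm
  obtain ⟨R, hR, hfR⟩ := exists_forall_norm_ge_fderiv_eq_zero hfc r₀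
  have hR0 : 0 < R := hr₀.trans hR
  have hf2 : ContDiff ℝ 2 f := hf.of_le (by norm_cast)
  have hf1 : ∀ x, ‖x‖ = R → f x = 0 ∧ fderiv ℝ f x = 0 := fun x hx =>
    ⟨(hfR x hx.ge).1, (hfR x hx.ge).2.1⟩
  set ω : ℝ → ℝ := fun r => (r + 1) ^ (-(2 * s)) with hω
  set e : ℝ → ℝ := fun r => Real.exp (2 * phi k τ' a' r / h) with he
  set v : ℝ → ℝ → ℝ := fun r θ => V (r • unitRadial θ) with hv
  set w := carlemanWeights hr₀ R h hk0 hk4 hs1 hs' hτ0 ha0 with hw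
  set u₁ := polarJet Complex.reCLM hf2 hr₀.le hR0.le hf0 hf1 with hu₁
  set u₂ := polarJet Complex.imCLM hf2 hr₀.le hR0.le hf0 hf1 with hu₂
  have hωi : ∀ r, 0 ≤ r → (r + 1) ^ (2 * s) = (ω r)⁻¹ := fun r hr => by
    simp only [hω]
    rw [Real.rpow_neg (by linarith), inv_inv]
  have hω0 : ∀ r ∈ Icc r₀ R, 0 < ω r := fun r hr =>
    Real.rpow_pos_of_pos (by linarith [hr.1]) _
  have hadd : ∀ c : ℝ, ContinuousOn (fun r : ℝ => (r + 1) ^ c) (Icc r₀ R) := fun c =>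
    (continuousOn_id.add continuousOn_const).rpow_const fun r hr =>
      Or.inl (show (0:ℝ) < r + 1 by linarith [hr.1]).ne'
  have hpair := u₁.pair_estimate u₂ w (v := v) (ω := ω) (c := c) (A := A) (M := M) (σ := σ)
    (B := fun r => C₂ * (r + 1) ^ (-β)) hE hh hr₀ hR.le
    ⟨(hVm.comp (continuous_fst.smul (continuous_unitRadial.comp continuous_snd)).measurable).aestronglyMeasurable,
      B, fun x _ => hB _⟩
    (fun θ => by
      obtain ⟨L, hL⟩ := hVlip _ (norm_unitRadial θ) R hR0
      refine (hL.mono ?_).absolutelyContinuousOnInterval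
      rw [uIcc_of_le hR.le]
      exact Icc_subset_Icc_left hr₀.le)
    (continuousOn_const.mul (hadd _))
    (fun θ => by
      filter_upwards [(ae_restrict_iff' measurableSet_Ici).1 (hVderiv _ (norm_unitRadial θ))] with r hr hr'
      exact hr (hr₀.le.trans hr'.1))
    (fun r hr => (hcar a' ha r hr.1).1)
    (fun r hr θ X Y => (hcar a' ha r hr.1).2 _ (by
      have := hVp (r • unitRadial θ)
      rwa [norm_smul_unitRadial (hr₀.le.trans hr.1)] at this) h hh hh1 X Y)
    hω0 (hadd _) hc0
    (fun r hr => hc ▸ radialWeightDeriv_ge hk0 hs1 (hr₀.le.trans hr.1))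
    (fun r hr => hA ▸ radialWeight_le hk0 hs1 ha0 (hr₀.le.trans hr.1))
    (fun r hr θ => by
      have h1 := phiDeriv_nonneg (a := a') hk0 hτ0 (hr₀.le.trans hr.1)
      have h2 := phiDeriv_le hk0 hτ0 ha0 (hr₀.le.trans hr.1)
      have h3 : phiDeriv k τ' a' r ^ 2 ≤ τ' ^ 2 := by gcongr
      have h4 := (abs_le.1 (hB (r • unitRadial θ))).1
      have h5 : h ^ 2 / (4 * r ^ 2) ≤ 1 / (4 * r₀ ^ 2) := by
        have := hr.1
        gcongr
        exact pow_le_one₀ hh.le hh1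
      rw [hM]
      change E + phiDeriv k τ' a' r ^ 2 - V (r • unitRadial θ) + h ^ 2 / (4 * r ^ 2) ≤ _
      linarith)
    hε hε1 hσ
  have hweighted := u₁.integral_weighted_le u₂ w (N := N) hr₀ hh hω0 (hadd _) fun r hr => by
    have h1 := phiDeriv_nonneg (a := a') hk0 hτ0 (hr₀.le.trans hr.1)
    have h2 := phiDeriv_le hk0 hτ0 ha0 (hr₀.le.trans hr.1)
    have h3 : 0 < h / (2 * r) := by
      have := hr₀.trans_le hr.1
      positivity
    have h4 : h / (2 * r) ≤ 1 / (2 * r₀) := by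
      have := hr.1
      gcongr
    change |phiDeriv k τ' a' r + h / (2 * r)| ≤ N
    rw [abs_of_nonneg (by linarith), hN]
    linarith
  have i1 : ∫ x in {x : EuclideanSpace ℝ (Fin 2) | r₀ ≤ ‖x‖},
      (‖x‖ + 1) ^ (-(2*s)) * Real.exp (2 * phi k τ' a' ‖x‖ / h) * ‖f x‖ ^ 2 =
      ∫ x in polarRect r₀ R, w.W x.1 * (ω x.1 * (u₁.g x.1 x.2 ^ 2 + u₂.g x.1 x.2 ^ 2)) := by
    rw [setIntegral_exterior_mul_mul_eq_polarRect (R := R) hr₀ ω e fun x hx => by simp [hfR x hx.le]]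
    simp_rw [Complex.sq_norm_eq]
    rfl
  have i2 : ∫ x in {x : EuclideanSpace ℝ (Fin 2) | r₀ ≤ ‖x‖},
      (‖x‖ + 1) ^ (-(2*s)) * Real.exp (2 * phi k τ' a' ‖x‖ / h) * ‖radialDeriv h f x‖ ^ 2 =
      ∫ x in polarRect r₀ R, w.W x.1 *
        (ω x.1 * ((h * u₁.gr x.1 x.2) ^ 2 + (h * u₂.gr x.1 x.2) ^ 2)) := by
    rw [setIntegral_exterior_mul_mul_eq_polarRect (R := R) hr₀ ω e fun x hx => by
      simp [radialDeriv, hfR x hx.le]]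
    refine setIntegral_congr_fun (measurableSet_polarRect r₀ R) fun x hx => ?_
    rw [sq_norm_radialDeriv h f (hr₀.trans_le hx.1.1)]
    rfl
  have i3 : ∫ x in {x : EuclideanSpace ℝ (Fin 2) | r₀ ≤ ‖x‖},
      (‖x‖ + 1) ^ (2*s) * Real.exp (2 * phi k τ' a' ‖x‖ / h) *
        ‖-(h:ℂ)^2 * lap f x
          + ((V x : ℂ) - (E:ℂ) + (σ:ℂ) * (ε:ℂ) * Complex.I) * f x‖ ^ 2 =
      ∫ x in polarRect r₀ R, w.W x.1 * ((ω x.1)⁻¹ *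
        ((u₁.op h E v x.1 x.2 - σ * ε * u₂.g x.1 x.2) ^ 2
          + (u₂.op h E v x.1 x.2 + σ * ε * u₁.g x.1 x.2) ^ 2)) := by
    rw [setIntegral_exterior_mul_mul_eq_polarRect (R := R) hr₀ (fun r => (r + 1) ^ (2 * s)) e fun x hx => by
      simp [hfR x hx.le]]
    refine setIntegral_congr_fun (measurableSet_polarRect r₀ R) fun x hx => ?_
    have hx0 : 0 < x.1 := hr₀.trans_le hx.1.1
    rw [hωi _ hx0.le, Complex.sq_norm_eq, hu₁, hu₂, hv, polarJet_op _ _ _ _ _ _ _ _ _ hx0.ne',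
      polarJet_op _ _ _ _ _ _ _ _ _ hx0.ne']
    change x.1 * e x.1 * ((ω x.1)⁻¹ * _) = x.1 * e x.1 * ((ω x.1)⁻¹ * ((_ - σ * ε * (f _).im) ^ 2 +
      (_ + σ * ε * (f _).re) ^ 2))
    have hh2 : -(h : ℂ) ^ 2 = ((-h ^ 2 : ℝ) : ℂ) := by push_cast; ring
    rw [hh2]
    refine congrArg (fun t => x.1 * e x.1 * ((ω x.1)⁻¹ * t)) ?_
    simp
    ring
  have i4 : ∫ x in {x : EuclideanSpace ℝ (Fin 2) | r₀ ≤ ‖x‖},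
      Real.exp (2 * phi k τ' a' ‖x‖ / h) * ‖f x‖ ^ 2 =
      ∫ x in polarRect r₀ R, w.W x.1 * (u₁.g x.1 x.2 ^ 2 + u₂.g x.1 x.2 ^ 2) := by
    have := setIntegral_exterior_mul_mul_eq_polarRect (R := R) hr₀ (fun _ => 1) e
      (F := fun x => ‖f x‖ ^ 2) fun x hx => by simp [hfR x hx.le]
    simp only [one_mul, Complex.sq_norm_eq] at this
    simp_rw [Complex.sq_norm_eq]
    exact this
  rw [i1, i2, i3, i4]
  have hW : ∀ x ∈ polarRect r₀ R, 0 ≤ w.W x.1 := fun x hx => w.W_nonneg _ hx.1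
  have hP : 0 ≤ ∫ x in polarRect r₀ R, w.W x.1 * ((ω x.1)⁻¹ *
      ((u₁.op h E v x.1 x.2 - σ * ε * u₂.g x.1 x.2) ^ 2
        + (u₂.op h E v x.1 x.2 + σ * ε * u₁.g x.1 x.2) ^ 2)) :=
    setIntegral_nonneg (measurableSet_polarRect r₀ R) fun x hx =>
      mul_nonneg (hW x hx) (mul_nonneg (inv_nonneg.2 (hω0 _ hx.1).le) (by positivity))
  have hQ : 0 ≤ ∫ x in polarRect r₀ R, w.W x.1 * (u₁.g x.1 x.2 ^ 2 + u₂.g x.1 x.2 ^ 2) :=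
    setIntegral_nonneg (measurableSet_polarRect r₀ R) fun x hx =>
      mul_nonneg (hW x hx) (by positivity)
  refine sqrt_add_sqrt_le_of_le hh hε hK0.le hP hQ ?_ ?_ ?_ hweighted.1 hweighted.2
  · exact le_mul_of_one_le_right (by positivity) (one_le_pow₀ ha1)
  · rw [mul_assoc]
    exact le_mul_of_one_le_right (by positivity) (one_le_mul_of_one_le_of_one_le hτ ha1)
  · rw [← hκ, ← hK₁, ← hK₂] at hpair
    rw [hK, mul_assoc (2 * (1 + N ^ 2))]
    refine mul_le_mul_of_nonneg_left ?_ (by positivity : 0 ≤ 2 * (1 + N ^ 2))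
    rw [div_mul_eq_mul_div]
    refine (le_div_iff₀' hκ0).2 (hpair.trans ?_)

    generalize (∫ x in polarRect r₀ R, w.W x.1 * ((ω x.1)⁻¹ *
      ((u₁.op h E v x.1 x.2 - σ * ε * u₂.g x.1 x.2) ^ 2
        + (u₂.op h E v x.1 x.2 + σ * ε * u₁.g x.1 x.2) ^ 2))) = P at hP ⊢
    generalize (∫ x in polarRect r₀ R, w.W x.1 * (u₁.g x.1 x.2 ^ 2 + u₂.g x.1 x.2 ^ 2)) = Q at hQ ⊢
    have h1 : 0 ≤ K₂ * (P / h ^ 2) := by positivity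
    have h2 : 0 ≤ K₁ * (ε / h * Q) := by positivity
    have h3 : K₁ / h ^ 2 * P + K₂ * (ε / h) * Q =
        (K₁ + K₂) * (P / h ^ 2 + ε / h * Q) - K₂ * (P / h ^ 2) - K₁ * (ε / h * Q) := by ring
    rw [h3]
    linarith
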